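/- arXiv:2002.08748 — 10 statements merged into one kernel-verified Lean document; each statement's English description precedes it below -/
import Mathlib

section
/- Let K be a field, let a_1,...,a_n ∈ K[x] be nonzero polynomials with f_i = deg(a_i), let 0 < N_i ≤ f_i for 1 ≤ i ≤ n and 0 < D ≤ min_i f_i be degree bounds, and assume Σ_{i=1}^n f_i = Σ_{i=1}^n N_i + D - 1. Then there exists a nonzero multivariate polynomial R over K in Σ_{i=1}^n f_i variables (indexed by the coefficients of x^k in u_i for 0 ≤ k < f_i, 1 ≤ i ≤ n) such that for every instance u = (u_1,...,u_n) ∈ K[x]^n with deg(u_i) < f_i whose coefficient vector does not annihilate R, the solution space S_u of the SRFR problem has dimension exactly 1 as a K-vector space. -/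
open Polynomial

section SRFR

variable {K : Type*} [Field K]

/-- Euclidean remainder by a fixed polynomial, as a linear map. -/
noncomputable def remainderLinearMap (a : K[X]) : K[X] →ₗ[K] K[X] where
  toFun p := p % a
  map_add' p q := Polynomial.add_mod p q a
  map_smul' c p := by
    simp only [Polynomial.mod_def, Polynomial.smul_modByMonic, RingHom.id_apply]

@[simp]
lemma remainderLinearMap_apply (a p : K[X]) : remainderLinearMap a p = p % a := rfl

lemma dvd_sub_mod (a p : K[X]) : a ∣ p - p % a :=
  ⟨p / a, by rw [sub_eq_iff_eq_add]; exact (EuclideanDomain.div_add_mod p a).symm⟩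

lemma sum_fin_smul_X_pow_eq (p : K[X]) {k : ℕ} (hp : p.degree < (k : WithBot ℕ)) :
    p = ∑ j : Fin k, p.coeff j • (X : K[X]) ^ (j : ℕ) := by
  rcases eq_or_ne p 0 with rfl | h
  · simp
  · have := p.as_sum_range_C_mul_X_pow' ((Polynomial.natDegree_lt_iff_degree_lt h).2 hp)
    rw [Fin.sum_univ_eq_sum_range (fun j => p.coeff j • (X : K[X]) ^ j) k]
    simpa only [Polynomial.smul_eq_C_mul] using this

/-- The solution space of simultaneous rational function reconstruction. -/
def srfrSolutions {n : ℕ} (a : Fin n → K[X]) (N : Fin n → ℕ) (D : ℕ) (u : Fin n → K[X]) :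
    Submodule K ((Fin n → K[X]) × K[X]) where
  carrier := {vd | (∀ i, a i ∣ (vd.1 i - vd.2 * u i) ∧ (vd.1 i).degree < (N i : WithBot ℕ)) ∧
    vd.2.degree < (D : WithBot ℕ)}
  zero_mem' := by simp
  add_mem' := by
    rintro ⟨v, d⟩ ⟨w, e⟩ ⟨h, hd⟩ ⟨h', he⟩
    refine ⟨fun i => ⟨?_, ?_⟩, ?_⟩
    · have := dvd_add (h i).1 (h' i).1
      convert this using 1
      simp only [Prod.mk_add_mk, Pi.add_apply]
      ring
    · exact (Polynomial.degree_add_le _ _).trans_lt (max_lt (h i).2 (h' i).2)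
    · exact (Polynomial.degree_add_le _ _).trans_lt (max_lt hd he)
  smul_mem' := by
    rintro c ⟨v, d⟩ ⟨h, hd⟩
    refine ⟨fun i => ⟨?_, ?_⟩, ?_⟩
    · have := (h i).1.mul_left (C c)
      convert this using 1
      simp only [Prod.smul_mk, Pi.smul_apply, Polynomial.smul_eq_C_mul]
      ring
    · exact (Polynomial.degree_smul_le _ _).trans_lt (h i).2
    · exact (Polynomial.degree_smul_le _ _).trans_lt hd

variable {n : ℕ} (a : Fin n → K[X]) (N g : Fin n → ℕ)

/-- The coefficients of `x ^ N i, …, x ^ (N i + g i - 1)` in the remainders of `d * u i`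
modulo `a i`, as a linear function of `d`. -/
noncomputable def highCoeffs (u : Fin n → K[X]) : K[X] →ₗ[K] ((Σ i, Fin (g i)) → K) :=
  LinearMap.pi fun v => Polynomial.lcoeff K (N v.1 + v.2) ∘ₗ remainderLinearMap (a v.1) ∘ₗ
    LinearMap.mulRight K (u v.1)

@[simp]
lemma highCoeffs_apply (u : Fin n → K[X]) (d : K[X]) (v : Σ i, Fin (g i)) :
    highCoeffs a N g u d v = ((d * u v.1) % a v.1).coeff (N v.1 + v.2) := rfl

/-- The matrix of `highCoeffs` on polynomials of degree less than `∑ i, g i`. -/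
noncomputable def highCoeffsMatrix (u : Fin n → K[X]) :
    Matrix (Fin (∑ i, g i)) (Fin (∑ i, g i)) K :=
  Matrix.of fun r m => highCoeffs a N g u (X ^ (m : ℕ)) (finSigmaFinEquiv.symm r)

/-- `highCoeffsMatrix` for the generic instance, whose coefficients are indeterminates. -/
noncomputable def genericHighCoeffsMatrix (f : Fin n → ℕ) :
    Matrix (Fin (∑ i, g i)) (Fin (∑ i, g i)) (MvPolynomial (Σ i, Fin (f i)) K) :=
  Matrix.of fun r m =>
    let v := finSigmaFinEquiv.symm r
    ∑ j : Fin (f v.1), MvPolynomial.C ((X ^ (m : ℕ) * X ^ (j : ℕ) % a v.1).coeff (N v.1 + v.2)) *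
      MvPolynomial.X ⟨v.1, j⟩

variable {a N g}

lemma eval_det_genericHighCoeffsMatrix (f : Fin n → ℕ) (u : Fin n → K[X])
    (hu : ∀ i, (u i).degree < (f i : WithBot ℕ)) :
    MvPolynomial.eval (fun v : Σ i, Fin (f i) => (u v.1).coeff (v.2 : ℕ))
      (genericHighCoeffsMatrix a N g f).det = (highCoeffsMatrix a N g u).det := by
  rw [RingHom.map_det]
  congr 1
  ext r m
  simp only [RingHom.mapMatrix_apply, Matrix.map_apply, genericHighCoeffsMatrix, Matrix.of_apply,
    map_sum, map_mul, MvPolynomial.eval_C, MvPolynomial.eval_X, highCoeffsMatrix]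
  set v := finSigmaFinEquiv.symm r
  have key : highCoeffs a N g u (X ^ (m : ℕ)) v =
      (Polynomial.lcoeff K (N v.1 + v.2) ∘ₗ remainderLinearMap (a v.1) ∘ₗ
        LinearMap.mulLeft K (X ^ (m : ℕ))) (u v.1) := rfl
  rw [key]
  conv_rhs => rw [sum_fin_smul_X_pow_eq (u v.1) (hu v.1), map_sum]
  refine Finset.sum_congr rfl fun j _ => ?_
  rw [map_smul, smul_eq_mul, mul_comm]
  rfl

lemma highCoeffsMatrix_mulVec (u : Fin n → K[X]) (c : Fin (∑ i, g i) → K) (r) :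
    (highCoeffsMatrix a N g u).mulVec c r =
      highCoeffs a N g u (∑ m, c m • X ^ (m : ℕ)) (finSigmaFinEquiv.symm r) := by
  rw [map_sum, Finset.sum_apply, Matrix.mulVec, dotProduct]
  refine Finset.sum_congr rfl fun m _ => ?_
  rw [map_smul, Pi.smul_apply, smul_eq_mul, mul_comm]
  rfl

lemma det_highCoeffsMatrix_ne_zero_iff (u : Fin n → K[X]) :
    (highCoeffsMatrix a N g u).det ≠ 0 ↔
      ∀ d : K[X], d.degree < ((∑ i, g i : ℕ) : WithBot ℕ) → highCoeffs a N g u d = 0 → d = 0 := by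
  rw [ne_eq, ← Matrix.exists_mulVec_eq_zero_iff]
  push Not
  constructor
  · intro h d hd h0
    by_contra hne
    refine h (fun m => d.coeff m) (fun hc => hne ?_) ?_
    · rw [sum_fin_smul_X_pow_eq d hd]
      exact Finset.sum_eq_zero fun m _ => by rw [show d.coeff m = 0 from congrFun hc m, zero_smul]
    · ext r
      rw [highCoeffsMatrix_mulVec, ← sum_fin_smul_X_pow_eq d hd, h0]
      rfl
  · intro h c hc h0
    refine hc ?_
    have hcoeff (k : Fin (∑ i, g i)) : (∑ m, c m • (X : K[X]) ^ (m : ℕ)).coeff k = c k := by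
      simp [Polynomial.finsetSum_coeff, Polynomial.coeff_X_pow, Fin.val_inj]
    have hz := h (∑ m, c m • X ^ (m : ℕ)) ?_ ?_
    · ext k
      rw [← hcoeff k, hz]
      rfl
    · refine (Polynomial.degree_sum_le _ _).trans_lt ?_
      refine (Finset.sup_lt_iff (WithBot.bot_lt_coe _)).2 fun m _ => ?_
      refine (Polynomial.degree_smul_le _ _).trans_lt ?_
      rw [Polynomial.degree_X_pow]
      exact_mod_cast m.2
    · ext v
      have := congrFun h0 (finSigmaFinEquiv v)
      rwa [highCoeffsMatrix_mulVec, Equiv.symm_apply_apply] at this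

section

variable (ha : ∀ i, a i ≠ 0) (hdeg : ∀ i, (a i).natDegree = N i + g i)

include ha hdeg

lemma highCoeffs_eq_zero_iff (u : Fin n → K[X]) (d : K[X]) :
    highCoeffs a N g u d = 0 ↔ ∀ i, (d * u i % a i).degree < (N i : WithBot ℕ) := by
  constructor
  · intro h i
    rw [Polynomial.degree_lt_iff_coeff_zero]
    intro m hm
    by_cases hmg : m < N i + g i
    · have := congrFun h ⟨i, ⟨m - N i, by omega⟩⟩
      simpa [Nat.add_sub_cancel' hm] using this
    · refine Polynomial.coeff_eq_zero_of_degree_lt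
        ((EuclideanDomain.mod_lt _ (ha i)).trans_le ?_)
      rw [Polynomial.degree_eq_natDegree (ha i), hdeg i]
      exact_mod_cast not_lt.1 hmg
  · intro h
    ext v
    exact (Polynomial.degree_lt_iff_coeff_zero _ _).1 (h v.1) _ (Nat.le_add_right _ _)

lemma mem_srfrSolutions_iff (D : ℕ) (u : Fin n → K[X]) (vd : (Fin n → K[X]) × K[X]) :
    vd ∈ srfrSolutions a N D u ↔ vd.1 = (fun i => vd.2 * u i % a i) ∧
      highCoeffs a N g u vd.2 = 0 ∧ vd.2.degree < (D : WithBot ℕ) := by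
  rw [highCoeffs_eq_zero_iff ha hdeg]
  constructor
  · rintro ⟨h, hd⟩
    have hv (i) : vd.1 i = vd.2 * u i % a i := by
      rw [← Polynomial.mod_eq_of_dvd_sub (h i).1, eq_comm, Polynomial.mod_eq_self_iff (ha i)]
      refine (h i).2.trans_le ?_
      rw [Polynomial.degree_eq_natDegree (ha i), hdeg i]
      exact_mod_cast Nat.le_add_right _ _
    exact ⟨funext hv, fun i => hv i ▸ (h i).2, hd⟩
  · rintro ⟨hv, h, hd⟩
    refine ⟨fun i => ⟨?_, ?_⟩, hd⟩
    · rw [hv, ← neg_sub, dvd_neg]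
      exact dvd_sub_mod _ _
    · rw [hv]
      exact h i

lemma finrank_srfrSolutions_eq_one (u : Fin n → K[X])
    (hu : (highCoeffsMatrix a N g u).det ≠ 0) :
    Module.finrank K (srfrSolutions a N (∑ i, g i + 1) u) = 1 := by
  rw [det_highCoeffsMatrix_ne_zero_iff] at hu
  have hzero (vd) (h : vd ∈ srfrSolutions a N (∑ i, g i + 1) u)
      (hc : vd.2.coeff (∑ i, g i) = 0) : vd = 0 := by
    obtain ⟨hv, h0, hd⟩ := (mem_srfrSolutions_iff ha hdeg _ u vd).1 h
    have hd0 : vd.2 = 0 := by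
      refine hu _ ?_ h0
      rw [Polynomial.degree_lt_iff_coeff_zero] at hd ⊢
      intro m hm
      rcases hm.eq_or_lt with rfl | hlt
      · exact hc
      · exact hd m hlt
    ext1
    · rw [hv, hd0]
      ext1 i
      simp
    · exact hd0
  obtain ⟨d, hd, hd0⟩ : ∃ d ∈ LinearMap.ker ((highCoeffs a N g u).domRestrict
      (Polynomial.degreeLT K (∑ i, g i + 1))), d ≠ 0 := by
    refine (Submodule.ne_bot_iff _).1 (LinearMap.ker_ne_bot_of_finrank_lt ?_)
    rw [(Polynomial.degreeLTEquiv K (∑ i, g i + 1)).finrank_eq]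
    simp
  have hw : ((fun i => (d : K[X]) * u i % a i), (d : K[X])) ∈
      srfrSolutions a N (∑ i, g i + 1) u :=
    (mem_srfrSolutions_iff ha hdeg _ u _).2 ⟨rfl, hd, Polynomial.mem_degreeLT.1 d.2⟩
  have hlead : (d : K[X]).coeff (∑ i, g i) ≠ 0 := fun hc =>
    hd0 (Subtype.ext (congrArg Prod.snd (hzero _ hw hc)))
  refine finrank_eq_one_iff'.2 ⟨⟨_, hw⟩, fun h => hd0 ?_, fun w => ?_⟩
  · exact Subtype.ext (congrArg (fun z => z.1.2) h)
  · refine ⟨(w : (Fin n → K[X]) × K[X]).2.coeff (∑ i, g i) / (d : K[X]).coeff (∑ i, g i), ?_⟩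
    rw [← sub_eq_zero]
    refine Subtype.ext (hzero _ (Subtype.property _) ?_)
    simp [hlead]

/-- There is an instance made of monomials for which `highCoeffs` is injective on polynomials
of degree less than `∑ i, g i`. -/
lemma exists_det_highCoeffsMatrix_ne_zero (hN : ∀ i, 0 < N i)
    (hg : ∀ i, ∑ l, g l < N i + g i) :
    ∃ u : Fin n → K[X], (∀ i, (u i).degree < ((N i + g i : ℕ) : WithBot ℕ)) ∧
      (highCoeffsMatrix a N g u).det ≠ 0 := by
  let E (i : Fin n) : ℕ := ∑ l : Fin i.val, g (Fin.castLE i.2.le l)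
  have hE (i : Fin n) (r : Fin (g i)) : (finSigmaFinEquiv ⟨i, r⟩ : ℕ) = E i + r :=
    finSigmaFinEquiv_apply ⟨i, r⟩
  refine ⟨fun i => X ^ (N i + g i - 1 - (E i + g i - 1)), fun i => ?_, ?_⟩
  · rw [Polynomial.degree_X_pow]
    have := hN i
    exact_mod_cast (show N i + g i - 1 - (E i + g i - 1) < N i + g i by omega)
  rw [det_highCoeffsMatrix_ne_zero_iff]
  intro d hd h
  rw [highCoeffs_eq_zero_iff ha hdeg] at h
  by_contra hd0
  rw [Polynomial.degree_eq_natDegree hd0] at hd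
  obtain ⟨⟨i, r⟩, hir⟩ := finSigmaFinEquiv.surjective
    (⟨d.natDegree, by exact_mod_cast hd⟩ : Fin (∑ i, g i))
  have hm : d.natDegree = E i + r := by rw [← hE, hir]
  have hr := r.2
  have ht := (finSigmaFinEquiv ⟨i, ⟨g i - 1, by omega⟩⟩ : Fin (∑ i, g i)).2
  rw [hE] at ht
  have hgi := hg i
  dsimp only at ht
  set q : K[X] := d * X ^ (N i + g i - 1 - (E i + g i - 1)) with hq
  have hp : (X ^ (g i - 1 - r) * q).degree = ((N i + g i - 1 : ℕ) : WithBot ℕ) := by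
    rw [hq, Polynomial.degree_mul, Polynomial.degree_mul, Polynomial.degree_X_pow,
      Polynomial.degree_X_pow, Polynomial.degree_eq_natDegree hd0, hm]
    norm_cast
    omega
  have hrem : (X ^ (g i - 1 - r) * (q % a i)).degree < (X ^ (g i - 1 - r) * q).degree := by
    rw [hp, Polynomial.degree_lt_iff_coeff_zero]
    intro m hm
    obtain ⟨m, rfl⟩ := Nat.exists_eq_add_of_le' (show g i - 1 - r ≤ m by omega)
    rw [Polynomial.coeff_X_pow_mul]
    exact (Polynomial.degree_lt_iff_coeff_zero _ _).1 (h i) m (by omega)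
  have hsub := Polynomial.degree_sub_eq_left_of_degree_lt hrem
  have hzero := Polynomial.eq_zero_of_dvd_of_degree_lt
    (p := a i) (q := X ^ (g i - 1 - r) * q - X ^ (g i - 1 - r) * (q % a i))
    (by rw [← mul_sub]; exact (dvd_sub_mod _ _).mul_left _)
    (by
      rw [hsub, hp, Polynomial.degree_eq_natDegree (ha i), hdeg i]
      exact_mod_cast (show N i + g i - 1 < N i + g i by omega))
  rw [hzero, hp, Polynomial.degree_zero] at hsub
  exact WithBot.bot_ne_coe hsub

end

end SRFR

/-- **Generic uniqueness of SRFR** (Theorem `thm:genUnicity`).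
If `Σ f_i = Σ N_i + D - 1`, there is a nonzero polynomial `R` in the coefficients of the
instance `u` such that whenever the coefficient vector of `u` does not annihilate `R`,
the SRFR solution space `S_u` has dimension exactly `1` over `K`. -/
theorem srfr_generic_uniqueness {K : Type*} [Field K] (n : ℕ) (hn : 0 < n)
    (a : Fin n → Polynomial K) (ha : ∀ i, a i ≠ 0)
    (f : Fin n → ℕ) (hf : ∀ i, f i = (a i).natDegree)
    (N : Fin n → ℕ) (D : ℕ)
    (hN0 : ∀ i, 0 < N i) (hNf : ∀ i, N i ≤ f i)
    (hD0 : 0 < D) (hDf : ∀ i, D ≤ f i)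
    (hsum : ∑ i, f i = ∑ i, N i + D - 1) :
    ∃ R : MvPolynomial (Σ i : Fin n, Fin (f i)) K, R ≠ 0 ∧
      ∀ u : Fin n → Polynomial K, (∀ i, (u i).degree < (f i : WithBot ℕ)) →
        MvPolynomial.eval (fun v : Σ i : Fin n, Fin (f i) => (u v.1).coeff (v.2 : ℕ)) R ≠ 0 →
        Module.finrank K (Submodule.span K
          {vd : (Fin n → Polynomial K) × Polynomial K |
            (∀ i, a i ∣ (vd.1 i - vd.2 * u i) ∧ (vd.1 i).degree < (N i : WithBot ℕ)) ∧
            vd.2.degree < (D : WithBot ℕ)}) = 1 := by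
  obtain ⟨g, hg⟩ : ∃ g : Fin n → ℕ, ∀ i, f i = N i + g i :=
    ⟨fun i => f i - N i, fun i => (Nat.add_sub_cancel' (hNf i)).symm⟩
  have hD : D = ∑ i, g i + 1 := by
    simp only [hg, Finset.sum_add_distrib] at hsum
    omega
  have hdeg (i) : (a i).natDegree = N i + g i := by rw [← hf, hg]
  refine ⟨(genericHighCoeffsMatrix a N g f).det, fun h => ?_, fun u hu h => ?_⟩
  · obtain ⟨u, hu, hu'⟩ := exists_det_highCoeffsMatrix_ne_zero ha hdeg hN0
      (fun i => by have := hDf i; have := hg i; omega)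
    refine hu' ?_
    rw [← eval_det_genericHighCoeffsMatrix f u (fun i => by rw [hg]; exact hu i), h, map_zero]
  · rw [eval_det_genericHighCoeffsMatrix f u hu] at h
    subst hD
    have := finrank_srfrSolutions_eq_one ha hdeg u h
    rwa [← Submodule.span_eq (srfrSolutions a N (∑ i, g i + 1) u)] at this
end

section
/- Let K be a field, a ∈ K[x] nonzero, a_1 = ... = a_n = a, N_1 = ... = N_n = N with 0 < N ≤ deg(a) and 0 < D ≤ deg(a). Let u = (u_1,...,u_n) ∈ K[x]^n with deg(u_i) < deg(a), and let k be the minimal positive integer such that deg(a) ≥ N + (D-1)/k. Then the rank s of the K[x]-module generated by the solution set S_u = {(v_1,...,v_n,d) ∈ K[x]^{n+1} : v_i ≡ d·u_i mod a, deg(v_i) < N, deg(d) < D} satisfies s ≤ k. -/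
open Polynomial

/-- If linearly independent subsets of `S` have at most `k` elements, then the module spanned by
`S` over a domain has rank at most `k`. -/
theorem rank_span_le_of_forall_not_linearIndependent {R M : Type*} [CommRing R] [IsDomain R]
    [AddCommGroup M] [Module R M] {S : Set M} {k : ℕ}
    (h : ∀ w : Fin (k + 1) → M, (∀ j, w j ∈ S) → ¬ LinearIndependent R w) :
    Module.rank R (Submodule.span R S) ≤ (k : Cardinal) := by
  obtain ⟨B, hB, hmax⟩ := exists_maximal_linearIndepOn R (Subtype.val : S → M)
  have hle : Submodule.span R (Subtype.val '' B) ≤ Submodule.span R S :=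
    Submodule.span_mono (by rintro _ ⟨x, -, rfl⟩; exact x.2)
  have htor : ∀ x ∈ Submodule.span R S,
      ∃ r : R, r ≠ 0 ∧ r • x ∈ Submodule.span R (Subtype.val '' B) := by
    intro x hx
    induction hx using Submodule.span_induction with
    | mem x hx =>
      by_cases hxB : (⟨x, hx⟩ : S) ∈ B
      · exact ⟨1, one_ne_zero, by
          rw [one_smul]; exact Submodule.subset_span ⟨_, hxB, rfl⟩⟩
      · exact hmax _ hxB
    | zero => exact ⟨1, one_ne_zero, by simp⟩
    | add x y _ _ hx hy =>
      obtain ⟨r, hr, hrx⟩ := hx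
      obtain ⟨s, hs, hsy⟩ := hy
      refine ⟨r * s, mul_ne_zero hr hs, ?_⟩
      rw [smul_add, mul_smul r s y, mul_comm r s, mul_smul s r x]
      exact add_mem (Submodule.smul_mem _ _ hrx) (Submodule.smul_mem _ _ hsy)
    | smul c x _ hx =>
      obtain ⟨r, hr, hrx⟩ := hx
      exact ⟨r, hr, by rw [smul_comm]; exact Submodule.smul_mem _ _ hrx⟩
  have hrank := Submodule.rank_quotient_add_rank
    ((Submodule.span R (Subtype.val '' B)).comap (Submodule.span R S).subtype)
  have hzero : Module.rank R (Submodule.span R S ⧸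
      (Submodule.span R (Subtype.val '' B)).comap (Submodule.span R S).subtype) = 0 := by
    rw [rank_eq_zero_iff]
    intro x
    obtain ⟨x, rfl⟩ := Submodule.Quotient.mk_surjective _ x
    obtain ⟨r, hr, hrx⟩ := htor x x.2
    refine ⟨r, hr, ?_⟩
    rw [← Submodule.Quotient.mk_smul, Submodule.Quotient.mk_eq_zero]
    exact hrx
  rw [hzero, zero_add, (Submodule.comapSubtypeEquivOfLe hle).rank_eq] at hrank
  rw [← hrank]
  by_contra! hlt
  have hcard : ((k + 1 : ℕ) : Cardinal) ≤ Cardinal.mk B := by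
    rw [Nat.cast_add_one, ← Cardinal.succ_natCast, Order.succ_le_iff]
    exact hlt.trans_le ((rank_span_le _).trans Cardinal.mk_image_le)
  obtain ⟨e⟩ : Nonempty (Fin (k + 1) ↪ B) := by
    rw [← Cardinal.lift_mk_le']
    simpa using hcard
  exact h (fun j => (e j : S)) (fun j => (e j : S).2) (hB.comp e e.injective)

/-- A nonzero column of a matrix over a field with linearly independent rows can be completed by
further columns to a nonzero maximal minor. -/
theorem exists_det_cons_ne_zero_of_field {F : Type*} [Field F] {k n : ℕ}
    (A : Fin (k + 1) → Fin n → F) {c : Fin (k + 1) → F} (hc : c ≠ 0)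
    (h : LinearIndependent F fun j => (A j, c j)) :
    ∃ f : Fin k → Fin n,
      (Matrix.of fun i j => (Fin.cons (c j) fun i => A j (f i) : Fin (k + 1) → F) i).det ≠ 0 := by
  let v : Option (Fin n) → Fin (k + 1) → F := fun o => o.elim c fun i j => A j i
  have hspan : Submodule.span F (Set.range v) = ⊤ := by
    by_contra hne
    obtain ⟨g, hg, hker⟩ := Submodule.exists_le_ker_of_lt_top _ (lt_top_iff_ne_top.2 hne)
    have hsum : ∀ x, g x = ∑ j, g (Pi.single j 1) * x j := by
      intro x
      conv_lhs => rw [pi_eq_sum_univ' x]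
      simp [map_sum, mul_comm]
    have hv : ∀ o, ∑ j, g (Pi.single j 1) * v o j = 0 := fun o => by
      rw [← hsum]
      exact hker (Submodule.subset_span ⟨o, rfl⟩)
    have hz := Fintype.linearIndependent_iff.1 h (fun j => g (Pi.single j 1)) (by
      ext i
      · simpa [v, Prod.fst_sum] using hv (some i)
      · simpa [v, Prod.snd_sum] using hv none)
    exact hg (LinearMap.ext fun x => by rw [hsum]; simp [hz])
  obtain ⟨b, -, hsb, htb, hb⟩ := exists_linearIndepOn_extension (K := F) (v := v) (s := {none})
    (t := Set.univ) (LinearIndepOn.singleton hc) (Set.subset_univ _)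
  have hcard : k + 1 ≤ b.ncard := by
    have h1 : Submodule.span F (v '' b) = ⊤ := by
      rw [eq_top_iff, ← hspan, Submodule.span_le, ← Set.image_univ]
      exact htb
    have := Fintype.ofFinite (v '' b)
    have h2 := finrank_span_le_card (R := F) (v '' b)
    rw [h1, finrank_top, Module.finrank_fin_fun, ← Set.ncard_eq_toFinset_card'] at h2
    exact h2.trans (Set.ncard_image_le)
  have hsome : k ≤ Nat.card {i : Fin n // some i ∈ b} := by
    have hsub : b ⊆ insert none (some '' {i : Fin n | some i ∈ b}) := by
      rintro (_ | i) hi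
      · exact Set.mem_insert _ _
      · exact Set.mem_insert_of_mem _ ⟨i, hi, rfl⟩
    have h1 := (Set.ncard_le_ncard hsub).trans (Set.ncard_insert_le _ _)
    rw [Set.ncard_image_of_injective _ (Option.some_injective _)] at h1
    exact Nat.le_of_succ_le_succ (hcard.trans h1)
  have := Fintype.ofFinite {i : Fin n // some i ∈ b}
  obtain ⟨f⟩ : Nonempty (Fin k ↪ {i : Fin n // some i ∈ b}) :=
    Function.Embedding.nonempty_of_card_le (by rwa [Fintype.card_fin, ← Nat.card_eq_fintype_card])
  refine ⟨fun i => f i, ?_⟩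
  let g : Fin (k + 1) → b := Fin.cons ⟨none, hsb rfl⟩ fun i => ⟨some (f i), (f i).2⟩
  have hg : Function.Injective g := by
    refine Fin.cons_injective_iff.2 ⟨?_, ?_⟩
    · rintro ⟨i, hi⟩
      simp at hi
    · intro i j hij
      exact f.injective (Subtype.ext (by simpa using hij))
  have hrow : LinearIndependent F (Matrix.of fun i j =>
      (Fin.cons (c j) fun i => A j (f i) : Fin (k + 1) → F) i).row := by
    have hrow_eq : (Matrix.of fun i j =>
        (Fin.cons (c j) fun i => A j (f i) : Fin (k + 1) → F) i).row = fun i => v (g i) := by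
      ext i j
      refine Fin.cases ?_ (fun i => ?_) i <;> simp [g, v]
    rw [hrow_eq]
    exact hb.comp g hg
  exact ((Matrix.isUnit_iff_isUnit_det _).1
    (Matrix.linearIndependent_rows_iff_isUnit.1 hrow)).ne_zero

/-- A nonzero column of a matrix over a domain with linearly independent rows can be completed by
further columns to a nonzero maximal minor. -/
theorem exists_det_cons_ne_zero {R : Type*} [CommRing R] [IsDomain R] {k n : ℕ}
    (A : Fin (k + 1) → Fin n → R) {c : Fin (k + 1) → R} (hc : c ≠ 0)
    (h : LinearIndependent R fun j => (A j, c j)) :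
    ∃ f : Fin k → Fin n,
      (Matrix.of fun i j => (Fin.cons (c j) fun i => A j (f i) : Fin (k + 1) → R) i).det ≠ 0 := by
  have hinj := IsFractionRing.injective R (FractionRing R)
  let φ : ((Fin n → R) × R) →ₗ[R] (Fin n → FractionRing R) × FractionRing R :=
    ((Algebra.linearMap R (FractionRing R)).compLeft (Fin n)).prodMap
      (Algebra.linearMap R (FractionRing R))
  have hφ : Function.Injective φ :=
    Function.Injective.prodMap hinj.comp_left hinj
  have hF := (LinearIndependent.iff_fractionRing R (FractionRing R)).1
    (h.map' φ (LinearMap.ker_eq_bot.2 hφ))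
  obtain ⟨f, hf⟩ := exists_det_cons_ne_zero_of_field
    (fun j i => algebraMap R (FractionRing R) (A j i))
    (c := fun j => algebraMap R (FractionRing R) (c j))
    (fun h0 => hc (funext fun j => hinj (by simpa using congrFun h0 j))) hF
  refine ⟨f, fun h0 => hf ?_⟩
  rw [← map_zero (algebraMap R (FractionRing R)), ← h0, RingHom.map_det]
  congr 1
  ext i j
  refine Fin.cases ?_ (fun i => ?_) i <;> simp

/-- A determinant having a column `d` and `k` further columns congruent to multiples of `d` modulo
`a` is divisible by `a ^ k`. -/
theorem pow_dvd_det_cons {R : Type*} [CommRing R] {k : ℕ} {a : R} (d : Fin (k + 1) → R)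
    (v : Fin k → Fin (k + 1) → R) (u : Fin k → R) (h : ∀ i j, a ∣ v i j - d j * u i) :
    a ^ k ∣ (Matrix.of fun i j => (Fin.cons (d j) fun i => v i j : Fin (k + 1) → R) i).det := by
  choose q hq using h
  have h1 : (Matrix.of fun i j => (Fin.cons (d j) fun i => v i j : Fin (k + 1) → R) i).det =
      (Matrix.of fun i j => (Fin.cons 1 (fun _ => a) : Fin (k + 1) → R) i *
        (Fin.cons (d j) fun i => q i j : Fin (k + 1) → R) i).det := by
    refine Matrix.det_eq_of_forall_row_eq_smul_add_const (Fin.cons 0 u) 0 rfl fun i j => ?_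
    refine Fin.cases ?_ (fun i => ?_) i
    · simp
    · simp [← hq]
      ring
  rw [h1.trans (Matrix.det_mul_column (Fin.cons 1 fun _ => a)
    (Matrix.of fun i j => (Fin.cons (d j) fun i => q i j : Fin (k + 1) → R) i)),
    Fin.prod_univ_succ]
  simp

/-- Degree bound for a determinant whose rows have bounded degrees. -/
theorem natDegree_det_le_sum {R ι : Type*} [CommRing R] [Fintype ι] [DecidableEq ι]
    (M : Matrix ι ι (Polynomial R)) (b : ι → ℕ) (h : ∀ i j, (M i j).natDegree ≤ b i) :
    M.det.natDegree ≤ ∑ i, b i := by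
  rw [← Matrix.det_transpose, Matrix.det_apply]
  refine natDegree_sum_le_of_forall_le _ _ fun σ _ => ?_
  refine (natDegree_smul_le _ _).trans ((natDegree_prod_le _ _).trans ?_)
  exact Finset.sum_le_sum fun i _ => h i _

theorem natDegree_le_sub_one_of_degree_lt {R : Type*} [Semiring R] {p : Polynomial R} {m : ℕ}
    (h : p.degree < m) : p.natDegree ≤ m - 1 := by
  rcases eq_or_ne p 0 with rfl | hp
  · simp
  · exact Nat.le_sub_one_of_lt ((natDegree_lt_iff_degree_lt hp).2 h)

/-- **Olesh–Storjohann rank bound** (Theorem 4.2 of `olesh_vector_2007`).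
With a common modulus `a` and a common numerator bound `N`, if `k` is the minimal positive
integer such that `deg a ≥ N + (D-1)/k`, then the rank of the `K[x]`-module generated by the
SRFR solution set `S_u` is at most `k`. -/
theorem srfr_rank_bound {K : Type*} [Field K] (n : ℕ) (hn : 0 < n)
    (a : Polynomial K) (ha : a ≠ 0)
    (N D : ℕ) (hN0 : 0 < N) (hN : N ≤ a.natDegree) (hD0 : 0 < D) (hD : D ≤ a.natDegree)
    (u : Fin n → Polynomial K) (hu : ∀ i, (u i).degree < a.degree)
    (k : ℕ) (hk0 : 0 < k)
    (hk : (N : ℚ) + ((D : ℚ) - 1) / (k : ℚ) ≤ (a.natDegree : ℚ))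
    (hkmin : ∀ k' : ℕ, 0 < k' → k' < k →
      ¬((N : ℚ) + ((D : ℚ) - 1) / (k' : ℚ) ≤ (a.natDegree : ℚ))) :
    Module.rank (Polynomial K)
      (Submodule.span (Polynomial K)
        {vd : (Fin n → Polynomial K) × Polynomial K |
          (∀ i, a ∣ (vd.1 i - vd.2 * u i) ∧ (vd.1 i).degree < (N : WithBot ℕ)) ∧
          vd.2.degree < (D : WithBot ℕ)}) ≤ (k : Cardinal) := by
  refine rank_span_le_of_forall_not_linearIndependent fun w hw hli => ?_
  have hd : (fun j => (w j).2) ≠ 0 := by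
    intro h0
    have hd0 : (w 0).2 = 0 := congrFun h0 0
    refine hli.ne_zero 0 (Prod.ext (funext fun i => ?_) hd0)
    obtain ⟨hdvd, hdeg⟩ := (hw 0).1 i
    rw [hd0, zero_mul, sub_zero] at hdvd
    refine Polynomial.eq_zero_of_dvd_of_degree_lt hdvd (hdeg.trans_le ?_)
    rw [degree_eq_natDegree ha]
    exact_mod_cast hN
  obtain ⟨f, hf⟩ := exists_det_cons_ne_zero (fun j => (w j).1) hd hli
  have hdvd := pow_dvd_det_cons (a := a) (fun j => (w j).2) (fun i j => (w j).1 (f i))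
    (fun i => u (f i)) fun i j => ((hw j).1 (f i)).1
  have hlow := natDegree_le_of_dvd hdvd hf
  have hupp := natDegree_det_le_sum
    (Matrix.of fun i j =>
      (Fin.cons (w j).2 fun i => (w j).1 (f i) : Fin (k + 1) → Polynomial K) i)
    (Fin.cons (D - 1) fun _ => N - 1) fun i j => by
      refine Fin.cases ?_ (fun i => ?_) i
      · simpa using natDegree_le_sub_one_of_degree_lt (hw j).2
      · simpa using natDegree_le_sub_one_of_degree_lt ((hw j).1 (f i)).2
  rw [natDegree_pow] at hlow
  simp only [Fin.sum_univ_succ, Fin.cons_zero, Fin.cons_succ, Finset.sum_const, Finset.card_univ,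
    Fintype.card_fin, smul_eq_mul] at hupp
  have hkQ : (0 : ℚ) < k := by exact_mod_cast hk0
  have hdegQ : (k : ℚ) * N + (D - 1) ≤ k * a.natDegree := by
    calc (k : ℚ) * N + (D - 1) = k * (N + (D - 1) / k) := by field_simp
      _ ≤ k * a.natDegree := mul_le_mul_of_nonneg_left hk hkQ.le
  have hle := hlow.trans hupp
  obtain ⟨D, rfl⟩ := Nat.exists_eq_add_of_lt hD0
  obtain ⟨N, rfl⟩ := Nat.exists_eq_add_of_lt hN0
  simp only [zero_add, Nat.add_sub_cancel] at hle
  have hleQ : (k : ℚ) * a.natDegree ≤ D + k * N := by exact_mod_cast hle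
  push_cast at hdegQ
  linarith
end

section
/- Let K be a field, s ∈ Z^ν a shift, N a K[x]-submodule of K[x]^{1×ν} of rank ρ, and P ∈ K[x]^{ρ×ν} an s-reduced basis of N with s-row degrees rdeg_s(P) = (r_1,...,r_ρ). Then for every integer r, the K-vector space N_{<r} := {p ∈ N : rdeg_s(p) < r} has dimension dim_K N_{<r} = Σ_{i : r_i < r} (r - r_i). -/
open Polynomial

noncomputable section

/-- s-row degree of a row vector of polynomials, with `deg 0 = ⊥`. -/
def rdeg {K : Type*} [Field K] {ν : ℕ} (s : Fin ν → ℤ) (p : Fin ν → Polynomial K) : WithBot ℤ :=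
  Finset.univ.sup fun i => WithBot.map (fun d : ℕ => (d : ℤ) + s i) (p i).degree

/-- s-leading matrix: the (i,j) entry is the coefficient of `x^(rdeg_s(P_i) - s_j)` in P_{i,j}. -/
def leadingMatrix {K : Type*} [Field K] {ρ ν : ℕ} (s : Fin ν → ℤ)
    (P : Fin ρ → Fin ν → Polynomial K) : Matrix (Fin ρ) (Fin ν) K :=
  Matrix.of fun i j =>
    if WithBot.map (fun d : ℕ => (d : ℤ) + s j) ((P i j).degree) = rdeg s (P i) then
      (P i j).leadingCoeff else 0

/-- P (given by its rows) is a basis of the K[x]-module N. -/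
def IsBasisOf {K : Type*} [Field K] {ρ ν : ℕ} (P : Fin ρ → Fin ν → Polynomial K)
    (N : Submodule (Polynomial K) (Fin ν → Polynomial K)) : Prop :=
  LinearIndependent (Polynomial K) P ∧ Submodule.span (Polynomial K) (Set.range P) = N

/-- The coefficient of `x^z` in `p` for an integer exponent `z`, zero if `z` is negative. -/
def intCoeff {K : Type*} [Field K] (p : K[X]) (z : ℤ) : K :=
  if 0 ≤ z then p.coeff z.toNat else 0

theorem intCoeff_mul_add {K : Type*} [Field K] {p q : K[X]} {y z : ℤ}
    (hp : ∀ d : ℕ, y < d → p.coeff d = 0) (hq : ∀ d : ℕ, z < d → q.coeff d = 0) :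
    intCoeff (p * q) (y + z) = intCoeff p y * intCoeff q z := by
  rcases lt_or_ge y 0 with hy | hy
  · have : p = 0 := by
      ext d
      exact hp d (by lia)
    simp [this, intCoeff]
  rcases lt_or_ge z 0 with hz | hz
  · have : q = 0 := by
      ext d
      exact hq d (by lia)
    simp [this, intCoeff]
  lift y to ℕ using hy
  lift z to ℕ using hz
  have h : intCoeff (p * q) (y + z) = (p * q).coeff (y + z) := by
    rw [intCoeff, if_pos (by lia)]
    congr 1
  rw [h, intCoeff, intCoeff, if_pos (by lia), if_pos (by lia)]
  exact coeff_mul_add_eq_of_natDegree_le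
    (natDegree_le_iff_coeff_eq_zero.2 fun d hd => hp d (by exact_mod_cast hd))
    (natDegree_le_iff_coeff_eq_zero.2 fun d hd => hq d (by exact_mod_cast hd))

theorem rdeg_lt_iff {K : Type*} [Field K] {ν : ℕ} (s : Fin ν → ℤ) (p : Fin ν → K[X]) (r : ℤ) :
    rdeg s p < (r : WithBot ℤ) ↔ ∀ j, ∀ d : ℕ, r ≤ d + s j → (p j).coeff d = 0 := by
  rw [rdeg, Finset.sup_lt_iff (WithBot.bot_lt_coe r)]
  simp only [Finset.mem_univ, true_imp_iff]
  refine forall_congr' fun j => ?_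
  by_cases h : p j = 0
  · simp [h, WithBot.bot_lt_coe]
  rw [degree_eq_natDegree h]
  change (((p j).natDegree + s j : ℤ) : WithBot ℤ) < r ↔ _
  rw [WithBot.coe_lt_coe]
  constructor
  · intro hr d hd
    exact coeff_eq_zero_of_natDegree_lt (by lia)
  · intro hc
    by_contra! hr
    exact h (leadingCoeff_eq_zero.1 (hc _ hr))

theorem coeff_eq_zero_of_rdeg_eq {K : Type*} [Field K] {ν : ℕ} {s : Fin ν → ℤ}
    {p : Fin ν → K[X]} {r : ℤ} (h : rdeg s p = (r : WithBot ℤ)) (j : Fin ν) (d : ℕ)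
    (hd : r < d + s j) : (p j).coeff d = 0 :=
  (rdeg_lt_iff s p (r + 1)).1 (by rw [h, WithBot.coe_lt_coe]; lia) j d (by lia)

theorem leadingMatrix_apply {K : Type*} [Field K] {ρ ν : ℕ} {s : Fin ν → ℤ}
    {P : Fin ρ → Fin ν → K[X]} {rv : Fin ρ → ℤ}
    (hrv : ∀ i, rdeg s (P i) = (rv i : WithBot ℤ)) (i : Fin ρ) (j : Fin ν) :
    leadingMatrix s P i j = intCoeff (P i j) (rv i - s j) := by
  rw [leadingMatrix, Matrix.of_apply, hrv]
  by_cases h : P i j = 0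
  · simp [h, intCoeff]
  rw [degree_eq_natDegree h]
  change (if (((P i j).natDegree + s j : ℤ) : WithBot ℤ) = rv i then _ else _) = _
  simp only [WithBot.coe_inj]
  have hle : (P i j).natDegree + s j ≤ rv i := by
    by_contra! hlt
    exact h (leadingCoeff_eq_zero.1 (coeff_eq_zero_of_rdeg_eq (hrv i) j _ hlt))
  split_ifs with heq
  · rw [intCoeff, if_pos (by lia), show (rv i - s j).toNat = (P i j).natDegree by lia]
    rfl
  · rw [intCoeff]
    split_ifs
    · exact (coeff_eq_zero_of_natDegree_lt (by lia)).symm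
    · rfl

theorem vecMul_injective_of_rank_eq {K : Type*} [Field K] {ρ ν : ℕ}
    {A : Matrix (Fin ρ) (Fin ν) K} (hA : A.rank = ρ) : Function.Injective A.vecMul := by
  rw [Matrix.vecMul_injective_iff, linearIndependent_iff_card_eq_finrank_span, Fintype.card_fin,
    Set.finrank, ← Matrix.rank_eq_finrank_span_row, hA]

/-- The predictable degree property of `s`-reduced matrices. -/
theorem rdeg_sum_smul_lt_iff {K : Type*} [Field K] {ρ ν : ℕ} {s : Fin ν → ℤ}
    {P : Fin ρ → Fin ν → K[X]} (hreduced : (leadingMatrix s P).rank = ρ)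
    {rv : Fin ρ → ℤ} (hrv : ∀ i, rdeg s (P i) = (rv i : WithBot ℤ))
    (u : Fin ρ → K[X]) (r : ℤ) :
    rdeg s (∑ i, u i • P i) < (r : WithBot ℤ) ↔
      ∀ i, ∀ d : ℕ, r ≤ d + rv i → (u i).coeff d = 0 := by
  rw [rdeg_lt_iff]
  constructor
  · intro h
    have step (m : ℤ) (hm : r ≤ m) (hu : ∀ i, ∀ d : ℕ, m + 1 ≤ d + rv i → (u i).coeff d = 0) :
        ∀ i, ∀ d : ℕ, m ≤ d + rv i → (u i).coeff d = 0 := by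
      have hc : (fun i => intCoeff (u i) (m - rv i)) = 0 := by
        apply vecMul_injective_of_rank_eq hreduced
        change Matrix.vecMul _ _ = Matrix.vecMul 0 _
        rw [Matrix.zero_vecMul]
        ext j
        have hterm (i : Fin ρ) : intCoeff (u i) (m - rv i) * leadingMatrix s P i j =
            intCoeff (u i * P i j) (m - s j) := by
          rw [leadingMatrix_apply hrv, ← intCoeff_mul_add
            (fun d hd => hu i d (by lia))
            (fun d hd => coeff_eq_zero_of_rdeg_eq (hrv i) j d (by lia))]
          congr 1
          ring
        simp only [Matrix.vecMul, dotProduct, hterm, Pi.zero_apply]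
        by_cases hz : 0 ≤ m - s j
        · simp only [intCoeff, if_pos hz]
          simpa [Finset.sum_apply, finsetSum_coeff] using h j (m - s j).toNat (by lia)
        · simp only [intCoeff, if_neg hz, Finset.sum_const_zero]
      intro i d hd
      rcases hd.eq_or_lt with heq | hlt
      · have := congrFun hc i
        simpa [intCoeff, heq] using this
      · exact hu i d (by lia)
    have descend (t : ℕ) : (∀ i, ∀ d : ℕ, r + t ≤ d + rv i → (u i).coeff d = 0) →
        ∀ i, ∀ d : ℕ, r ≤ d + rv i → (u i).coeff d = 0 := by
      induction t with
      | zero => simp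
      | succ t ih =>
        intro hu
        exact ih (step (r + t) (by lia) fun i d hd => hu i d (by push_cast; lia))
    refine descend (∑ i, ((u i).natDegree + 1 + (rv i - r).toNat)) fun i d hd => ?_
    have hi := Finset.single_le_sum
      (f := fun i => (u i).natDegree + 1 + (rv i - r).toNat) (fun _ _ => Nat.zero_le _)
      (Finset.mem_univ i)
    exact coeff_eq_zero_of_natDegree_lt (by lia)
  · intro hu j d hd
    simp only [Finset.sum_apply, Pi.smul_apply, smul_eq_mul, finsetSum_coeff]
    refine Finset.sum_eq_zero fun i _ => ?_
    rw [coeff_mul]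
    refine Finset.sum_eq_zero fun ab hab => ?_
    rw [Finset.HasAntidiagonal.mem_antidiagonal] at hab
    by_cases ha : r ≤ ab.1 + rv i
    · rw [hu i _ ha, zero_mul]
    · rw [coeff_eq_zero_of_rdeg_eq (hrv i) j ab.2 (by lia), mul_zero]

/-- The `K`-linear map sending bounded-degree coefficients to a combination of the rows of `P`. -/
def boundedCombination {K : Type*} [Field K] {ρ ν : ℕ} (P : Fin ρ → Fin ν → K[X])
    (n : Fin ρ → ℕ) : (∀ i, degreeLT K (n i)) →ₗ[K] (Fin ν → K[X]) :=
  (Fintype.linearCombination K[X] P).restrictScalars K ∘ₗ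
    LinearMap.pi fun i => (degreeLT K (n i)).subtype ∘ₗ LinearMap.proj i

theorem boundedCombination_apply {K : Type*} [Field K] {ρ ν : ℕ} (P : Fin ρ → Fin ν → K[X])
    (n : Fin ρ → ℕ) (v : ∀ i, degreeLT K (n i)) :
    boundedCombination P n v = ∑ i, (v i : K[X]) • P i := rfl

theorem boundedCombination_injective {K : Type*} [Field K] {ρ ν : ℕ} {P : Fin ρ → Fin ν → K[X]}
    (hP : LinearIndependent K[X] P) (n : Fin ρ → ℕ) :
    Function.Injective (boundedCombination P n) := by
  intro v w h
  have := hP.fintypeLinearCombination_injective h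
  ext1 i
  exact Subtype.ext (congrFun this i)

theorem finrank_pi_degreeLT {K : Type*} [Field K] {ρ : ℕ} (n : Fin ρ → ℕ) :
    Module.finrank K (∀ i, degreeLT K (n i)) = ∑ i, n i := by
  rw [(LinearEquiv.piCongrRight fun i => degreeLTEquiv K (n i)).finrank_eq,
    Module.finrank_pi_fintype]
  simp

theorem coe_range_boundedCombination {K : Type*} [Field K] {ρ ν : ℕ} {s : Fin ν → ℤ}
    {P : Fin ρ → Fin ν → K[X]} (hreduced : (leadingMatrix s P).rank = ρ)
    {rv : Fin ρ → ℤ} (hrv : ∀ i, rdeg s (P i) = (rv i : WithBot ℤ)) (r : ℤ) :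
    (LinearMap.range (boundedCombination P fun i => (r - rv i).toNat) : Set (Fin ν → K[X])) =
      {p | p ∈ Submodule.span K[X] (Set.range P) ∧ rdeg s p < (r : WithBot ℤ)} := by
  have hmem (i : Fin ρ) (u : K[X]) : u ∈ degreeLT K (r - rv i).toNat ↔
      ∀ d : ℕ, r ≤ d + rv i → u.coeff d = 0 := by
    rw [mem_degreeLT, degree_lt_iff_coeff_zero]
    exact forall_congr' fun d => imp_congr_left (by lia)
  ext p
  simp only [SetLike.mem_coe, LinearMap.mem_range, Set.mem_ofPred_eq,
    Submodule.mem_span_range_iff_exists_fun, boundedCombination_apply]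
  constructor
  · rintro ⟨v, rfl⟩
    exact ⟨⟨_, rfl⟩, (rdeg_sum_smul_lt_iff hreduced hrv _ r).2 fun i => (hmem i _).1 (v i).2⟩
  · rintro ⟨⟨u, rfl⟩, hu⟩
    exact ⟨fun i => ⟨u i, (hmem i _).2 ((rdeg_sum_smul_lt_iff hreduced hrv u r).1 hu i)⟩, rfl⟩

/-- **Dimension of the degree-restricted part of a module with an s-reduced basis.**
If `P` is an `s`-reduced basis of `N` with `s`-row degrees `rv`, then
`dim_K N_{<r} = Σ_{i : rv i < r} (r - rv i)`. -/
theorem dim_module_lt_of_reduced_basis {K : Type*} [Field K] {ρ ν : ℕ} (s : Fin ν → ℤ)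
    (N : Submodule (Polynomial K) (Fin ν → Polynomial K))
    (P : Fin ρ → Fin ν → Polynomial K)
    (hbasis : IsBasisOf P N)
    (hreduced : (leadingMatrix s P).rank = ρ)
    (rv : Fin ρ → ℤ) (hrv : ∀ i, rdeg s (P i) = (rv i : WithBot ℤ))
    (r : ℤ) :
    Module.finrank K (Submodule.span K
        {p : Fin ν → Polynomial K | p ∈ N ∧ rdeg s p < (r : WithBot ℤ)})
      = (∑ i ∈ Finset.univ.filter (fun i => rv i < r), (r - rv i)).toNat := by
  obtain ⟨hP, rfl⟩ := hbasis
  rw [← coe_range_boundedCombination hreduced hrv r, Submodule.span_eq,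
    LinearMap.finrank_range_of_inj (boundedCombination_injective hP _), finrank_pi_degreeLT,
    ← Int.toNat_natCast (∑ i, _), Nat.cast_sum, Finset.sum_filter]
  congr 1
  refine Finset.sum_congr rfl fun i _ => ?_
  split_ifs <;> lia
end
end

section
/- Let K be a field, s ∈ Z^ν a shift, N a K[x]-submodule of K[x]^{1×ν}, and P a basis of N in s-weak Popov form with s-pivot degrees (d_1,...,d_ν) indexed by pivot index. If p ∈ N is nonzero with s-pivot index i, then the s-pivot degree of p is at least d_i; equivalently, rdeg_s(p) ≥ rdeg_s(P_{i,*}) where P_{i,*} is the row of P with s-pivot index i. -/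
open Polynomial

noncomputable section

/-- `p` has s-pivot index `i` and s-pivot degree `d`:
`i` is the largest index with `deg p_i + s_i = rdeg_s p`, and `deg p_i = d`. -/
def IsPivot {K : Type*} [Field K] {ν : ℕ} (s : Fin ν → ℤ) (p : Fin ν → Polynomial K)
    (i : Fin ν) (d : ℕ) : Prop :=
  (p i).degree = (d : WithBot ℕ) ∧
  WithBot.map (fun k : ℕ => (k : ℤ) + s i) (p i).degree = rdeg s p ∧
  ∀ j : Fin ν, WithBot.map (fun k : ℕ => (k : ℤ) + s j) (p j).degree = rdeg s p → j ≤ i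

theorem IsPivot.rdeg_eq {K : Type*} [Field K] {ν : ℕ} {s : Fin ν → ℤ}
    {p : Fin ν → Polynomial K} {i : Fin ν} {d : ℕ} (h : IsPivot s p i d) :
    rdeg s p = (((d : ℤ) + s i : ℤ) : WithBot ℤ) := by
  rw [← h.2.1, h.1]
  rfl

/-- The pivot entry maximises `(deg p_j + s_j, j)` lexicographically among the nonzero entries. -/
theorem IsPivot.le_lex {K : Type*} [Field K] {ν : ℕ} {s : Fin ν → ℤ}
    {p : Fin ν → Polynomial K} {i : Fin ν} {d : ℕ} (h : IsPivot s p i d)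
    {j : Fin ν} (hj : p j ≠ 0) :
    ((p j).natDegree : ℤ) + s j < d + s i ∨
      ((p j).natDegree : ℤ) + s j = d + s i ∧ j ≤ i := by
  have hmap : WithBot.map (fun n : ℕ => (n : ℤ) + s j) (p j).degree =
      ((((p j).natDegree : ℤ) + s j : ℤ) : WithBot ℤ) := by
    rw [degree_eq_natDegree hj]
    rfl
  have hle : WithBot.map (fun n : ℕ => (n : ℤ) + s j) (p j).degree ≤ rdeg s p :=
    Finset.le_sup (f := fun j => WithBot.map (fun n : ℕ => (n : ℤ) + s j) (p j).degree)
      (Finset.mem_univ j)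
  have hpiv := h.2.2 j
  rw [hmap, h.rdeg_eq, WithBot.coe_le_coe] at hle
  rw [hmap, h.rdeg_eq, WithBot.coe_inj] at hpiv
  exact hle.lt_or_eq.imp_right fun heq => ⟨heq, hpiv heq⟩

/-- **Degree minimality of weak Popov bases** (Lemma `lm:lemmPivot`).
If `P` is a basis of `N` in s-weak Popov form with s-pivot degrees `d` (indexed by rows with
pairwise distinct pivot indices `piv`), and `p ∈ N` is nonzero with the same s-pivot index
as row `k`, then the s-pivot degree of `p` is `≥ d k`, equivalently
`rdeg_s p ≥ rdeg_s (P_{k,*})`. -/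
theorem weak_popov_pivot_minimality {K : Type*} [Field K] {ρ ν : ℕ} (s : Fin ν → ℤ)
    (N : Submodule (Polynomial K) (Fin ν → Polynomial K))
    (P : Fin ρ → Fin ν → Polynomial K)
    (hbasis : IsBasisOf P N)
    (piv : Fin ρ → Fin ν) (d : Fin ρ → ℕ)
    (hpopov : ∀ k, IsPivot s (P k) (piv k) (d k))
    (hinj : Function.Injective piv)
    (p : Fin ν → Polynomial K) (hp : p ∈ N) (hpne : p ≠ 0)
    (k : Fin ρ) (e : ℕ) (hppiv : IsPivot s p (piv k) e) :
    d k ≤ e ∧ rdeg s (P k) ≤ rdeg s p := by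
  classical
  obtain ⟨-, rfl⟩ := hbasis
  obtain ⟨c, rfl⟩ := (Submodule.mem_span_range_iff_exists_fun _).mp hp
  have happ : ∀ i, (∑ j, c j • P j) i = ∑ j, c j * P j i := fun i => by
    simp [Finset.sum_apply]
  have hex : ∃ j, c j ≠ 0 := by
    by_contra! h
    exact hpne (by simp [h])
  -- The summand whose pivot is lexicographically largest determines the pivot of the sum.
  let w : Fin ρ → ℤ ×ₗ Fin ν := fun j => toLex (((c j).natDegree : ℤ) + d j + s (piv j), piv j)
  obtain ⟨m, hm, hmax⟩ := (Finset.univ.filter fun j => c j ≠ 0 : Finset (Fin ρ)).exists_max_image w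
    (hex.imp fun j hj => by simpa using hj)
  simp only [Finset.mem_filter, Finset.mem_univ, true_and] at hm hmax
  have hmax' : ∀ j, c j ≠ 0 →
      ((c j).natDegree : ℤ) + d j + s (piv j) < (c m).natDegree + d m + s (piv m) ∨
        ((c j).natDegree : ℤ) + d j + s (piv j) = (c m).natDegree + d m + s (piv m) ∧
          piv j ≤ piv m := fun j hj => by
    simpa [w, Prod.Lex.toLex_le_toLex] using hmax j hj
  have hPm : P m (piv m) ≠ 0 := fun h => by simpa [h] using (hpopov m).1
  have hdm : (P m (piv m)).natDegree = d m := natDegree_eq_of_degree_eq_some (hpopov m).1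
  have hdeg_m : (c m * P m (piv m)).degree = (((c m).natDegree + d m : ℕ) : WithBot ℕ) := by
    rw [degree_eq_natDegree (mul_ne_zero hm hPm), natDegree_mul hm hPm, hdm]
  have hdeg : ((∑ j, c j • P j) (piv m)).degree =
      (((c m).natDegree + d m : ℕ) : WithBot ℕ) := by
    rw [happ, ← Finset.add_sum_erase _ _ (Finset.mem_univ m), ← hdeg_m]
    refine degree_add_eq_left_of_degree_lt ?_
    rw [hdeg_m, degree_lt_iff_coeff_zero]
    intro n hn
    rw [finsetSum_coeff]
    refine Finset.sum_eq_zero fun j hj => coeff_eq_zero_of_degree_lt ?_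
    by_cases hz : c j * P j (piv m) = 0
    · simp [hz]
    obtain ⟨hc, hP⟩ := mul_ne_zero_iff.mp hz
    rw [degree_eq_natDegree hz, natDegree_mul hc hP, Nat.cast_lt]
    have h₁ := (hpopov j).le_lex hP
    have h₂ := hmax' j hc
    have hne : piv j ≠ piv m := fun h => Finset.ne_of_mem_erase hj (hinj h)
    omega
  have hpm : (∑ j, c j • P j) (piv m) ≠ 0 := fun h => by
    rw [h, degree_zero] at hdeg
    exact WithBot.bot_ne_coe hdeg
  have h₁ := hppiv.le_lex hpm
  rw [natDegree_eq_of_degree_eq_some hdeg] at h₁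
  obtain ⟨j, -, hj⟩ : ∃ j ∈ Finset.univ, (c j * P j (piv k)).coeff e ≠ 0 := by
    refine Finset.exists_ne_zero_of_sum_ne_zero ?_
    rw [← finsetSum_coeff, ← happ]
    exact coeff_ne_zero_of_eq_degree hppiv.1
  obtain ⟨hc, hP⟩ := mul_ne_zero_iff.mp fun h : c j * P j (piv k) = 0 => hj (by simp [h])
  have he := le_natDegree_of_ne_zero hj
  rw [natDegree_mul hc hP] at he
  have h₂ := (hpopov j).le_lex hP
  have h₃ := hmax' j hc
  have hmk : piv m = piv k := by omega
  obtain rfl := hinj hmk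
  have hde : d m ≤ e := by omega
  refine ⟨hde, ?_⟩
  rw [(hpopov m).rdeg_eq, hppiv.rdeg_eq, WithBot.coe_le_coe]
  omega
end
end

section
/- Let K be a field, m ≥ n ≥ 1, a_1,...,a_n ∈ K[x] nonzero, M = ⟨a_i(x)·ε'_i : 1 ≤ i ≤ n⟩ ⊆ K[x]^n, M ∈ K[x]^{m×n}, s ∈ Z^m a shift, and φ_M: K[x]^{1×m} → K[x]^n/M the map p ↦ pM mod M. Then for i ∈ {1,...,m} and d ∈ N, there exists p in the relation module A_{M,M} = ker(φ_M) with s-pivot index i and s-pivot degree d if and only if φ_M(x^d ε_i) lies in the K-linear span of {φ_M(x^k ε_j) : x^k ε_j ≺_{s-TOP} x^d ε_i}. -/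
open Polynomial

noncomputable section

/-- the submodule M = ⟨a_i ε'_i⟩ of K[x]^n -/
def Mmod {K : Type*} [Field K] {n : ℕ} (a : Fin n → Polynomial K) :
    Submodule (Polynomial K) (Fin n → Polynomial K) :=
  Submodule.span (Polynomial K) (Set.range fun i => Pi.single i (a i))

/-- row-vector times matrix: (p M)_j = Σ_i p_i M_{i,j} -/
def pmul {K : Type*} [Field K] {m n : ℕ} (M : Matrix (Fin m) (Fin n) (Polynomial K))
    (p : Fin m → Polynomial K) : Fin n → Polynomial K :=
  fun j => ∑ i, p i * M i j

/-- the monomial x^k ε_j of K[x]^{1×m}, encoded by the pair (k, j) -/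
def monov {K : Type*} [Field K] {m : ℕ} (μ : ℕ × Fin m) : Fin m → Polynomial K :=
  Pi.single μ.2 (X ^ μ.1)

/-- the s-TOP order on monomials: x^a ε_i ≺ x^b ε_j iff (a+s_i, i) <_lex (b+s_j, j) -/
def sTopLT {m : ℕ} (s : Fin m → ℤ) (μ ν : ℕ × Fin m) : Prop :=
  ((μ.1 : ℤ) + s μ.2 < (ν.1 : ℤ) + s ν.2) ∨
  ((μ.1 : ℤ) + s μ.2 = (ν.1 : ℤ) + s ν.2 ∧ μ.2 < ν.2)

/-- `p` has pivot `(d, i)` iff `x^d ε_i` is its leading monomial for the s-TOP order. -/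
theorem isPivot_iff_coeff {K : Type*} [Field K] {m : ℕ} (s : Fin m → ℤ)
    (p : Fin m → Polynomial K) (i : Fin m) (d : ℕ) :
    IsPivot s p i d ↔ (p i).coeff d ≠ 0 ∧
      ∀ j k, (p j).coeff k ≠ 0 → sTopLT s (k, j) (d, i) ∨ (k, j) = (d, i) := by
  constructor
  · rintro ⟨hd, hmax, hlast⟩
    have hrdeg : rdeg s p = (((d : ℤ) + s i : ℤ) : WithBot ℤ) := by
      rw [← hmax, hd]; rfl
    refine ⟨Polynomial.coeff_ne_zero_of_eq_degree hd, fun j k hk => ?_⟩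
    have hne : p j ≠ 0 := fun h => hk (by simp [h])
    have hke : k ≤ (p j).natDegree := Polynomial.le_natDegree_of_ne_zero hk
    have hdeg := Polynomial.degree_eq_natDegree hne
    have hmap : WithBot.map (fun k : ℕ => (k : ℤ) + s j) (p j).degree =
        ((((p j).natDegree : ℤ) + s j : ℤ) : WithBot ℤ) := by
      rw [hdeg]; rfl
    have hle : ((p j).natDegree : ℤ) + s j ≤ (d : ℤ) + s i := by
      rw [← WithBot.coe_le_coe, ← hmap, ← hrdeg]
      exact Finset.le_sup (f := fun j => WithBot.map (fun k : ℕ => (k : ℤ) + s j) (p j).degree)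
        (Finset.mem_univ j)
    by_cases hlt : (k : ℤ) + s j < (d : ℤ) + s i
    · exact Or.inl (Or.inl hlt)
    have hji : j ≤ i := hlast j (by
      rw [hmap, hrdeg, WithBot.coe_inj]; omega)
    rcases hji.lt_or_eq with h | rfl
    · exact Or.inl (Or.inr ⟨by dsimp only; omega, h⟩)
    · exact Or.inr (Prod.ext (by dsimp only; omega) rfl)
  · rintro ⟨hd, hall⟩
    have hle (j : Fin m) (k : ℕ) (hk : (p j).coeff k ≠ 0) : (k : ℤ) + s j ≤ (d : ℤ) + s i := by
      rcases hall j k hk with (h | h) | h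
      · exact h.le
      · exact h.1.le
      · rw [Prod.mk.injEq] at h
        rw [h.1, h.2]
    have hdeg : (p i).degree = d := by
      refine le_antisymm ((Polynomial.degree_le_iff_coeff_zero _ _).2 fun k hk => ?_)
        (Polynomial.le_degree_of_ne_zero hd)
      by_contra hne
      have := hle i k hne
      have := Nat.cast_lt.1 hk
      omega
    have hrdeg : rdeg s p = (((d : ℤ) + s i : ℤ) : WithBot ℤ) := by
      refine le_antisymm (Finset.sup_le fun j _ => ?_) ?_
      · by_cases hj : p j = 0
        · simp [hj]
        · rw [Polynomial.degree_eq_natDegree hj]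
          exact WithBot.coe_le_coe.2 (hle j _ (by simpa using hj))
      · have := Finset.le_sup (f := fun j => WithBot.map (fun k : ℕ => (k : ℤ) + s j) (p j).degree)
          (Finset.mem_univ i)
        rwa [hdeg] at this
    refine ⟨hdeg, by rw [hrdeg, hdeg]; rfl, fun j hj => ?_⟩
    rw [hrdeg] at hj
    obtain ⟨e, he, hes⟩ := WithBot.map_eq_some_iff.1 hj
    rcases hall j e (Polynomial.coeff_ne_zero_of_eq_degree he) with (h | h) | h
    · exact absurd hes h.ne
    · exact h.2.le
    · exact (congrArg Prod.snd h).le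

theorem coeff_monov {K : Type*} [Field K] {m : ℕ} (μ : ℕ × Fin m) (j : Fin m) (k : ℕ) :
    ((monov μ : Fin m → Polynomial K) j).coeff k = if (k, j) = μ then 1 else 0 := by
  obtain ⟨e, l⟩ := μ
  by_cases h : j = l
  · subst h; simp [monov, Polynomial.coeff_X_pow]
  · simp [monov, h]

theorem mem_span_monov_iff {K : Type*} [Field K] {m : ℕ} (S : Set (ℕ × Fin m))
    (q : Fin m → Polynomial K) :
    q ∈ Submodule.span K (monov '' S) ↔ ∀ j k, (q j).coeff k ≠ 0 → (k, j) ∈ S := by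
  constructor
  · intro hq
    induction hq using Submodule.span_induction with
    | mem x hx =>
      obtain ⟨μ, hμ, rfl⟩ := hx
      intro j k hk
      rw [coeff_monov] at hk
      have : (k, j) = μ := by by_contra h; exact hk (if_neg h)
      rwa [this]
    | zero => intro j k hk; simp at hk
    | add x y _ _ hx hy =>
      intro j k hk
      by_cases h : (x j).coeff k = 0
      · exact hy j k fun h' => hk (by simp [h, h'])
      · exact hx j k h
    | smul c x _ hx =>
      intro j k hk
      exact hx j k fun h => hk (by simp [h])
  · intro h
    have hq : q = ∑ j, ∑ k ∈ (q j).support, (q j).coeff k • monov (k, j) := by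
      funext l
      ext e
      simp only [Finset.sum_apply, Polynomial.finsetSum_coeff, Pi.smul_apply,
        Polynomial.coeff_smul, coeff_monov, Prod.mk.injEq, smul_eq_mul, mul_ite, mul_one,
        mul_zero]
      rw [Finset.sum_eq_single l]
      · simp
      · intro j _ hj
        simp [hj.symm]
      · simp
    rw [hq]
    exact Submodule.sum_mem _ fun j _ => Submodule.sum_mem _ fun k hk =>
      Submodule.smul_mem _ _ (Submodule.subset_span
        ⟨_, h j k (Polynomial.mem_support_iff.1 hk), rfl⟩)

theorem not_sTopLT_self {m : ℕ} (s : Fin m → ℤ) (μ : ℕ × Fin m) : ¬ sTopLT s μ μ := by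
  simp [sTopLT]

/-- The map `φ_M : p ↦ pM mod M`, as a `K`-linear map. -/
def relationMap {K : Type*} [Field K] {m n : ℕ} (a : Fin n → Polynomial K)
    (M : Matrix (Fin m) (Fin n) (Polynomial K)) :
    (Fin m → Polynomial K) →ₗ[K] (Fin n → Polynomial K) ⧸ Mmod a :=
  ((Mmod a).mkQ ∘ₗ Matrix.vecMulLinear M).restrictScalars K

theorem relationMap_apply {K : Type*} [Field K] {m n : ℕ} (a : Fin n → Polynomial K)
    (M : Matrix (Fin m) (Fin n) (Polynomial K)) (p : Fin m → Polynomial K) :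
    relationMap a M p = Submodule.Quotient.mk (pmul M p) :=
  rfl

/-- **Pivots of the relation module and linear dependency** (Proposition `prop:relation`).
There exists `p` in the relation module `A_{M,M} = {p : pM ≡ 0 mod M}` with s-pivot index `i`
and s-pivot degree `d` iff `φ_M(x^d ε_i)` lies in the K-linear span of the images
`φ_M(x^k ε_j)` of the monomials that are smaller for the s-TOP order. -/
theorem relation_module_pivot_iff {K : Type*} [Field K] {m n : ℕ} (hmn : n ≤ m) (hn : 0 < n)
    (a : Fin n → Polynomial K) (ha : ∀ i, a i ≠ 0)
    (M : Matrix (Fin m) (Fin n) (Polynomial K)) (s : Fin m → ℤ)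
    (i : Fin m) (d : ℕ) :
    (∃ p : Fin m → Polynomial K, pmul M p ∈ Mmod a ∧ IsPivot s p i d)
      ↔ (Submodule.Quotient.mk (pmul M (monov (d, i))) : (Fin n → Polynomial K) ⧸ Mmod a) ∈
          Submodule.span K
            ((fun μ : ℕ × Fin m =>
                (Submodule.Quotient.mk (pmul M (monov μ)) : (Fin n → Polynomial K) ⧸ Mmod a)) ''
              {μ | sTopLT s μ (d, i)}) := by
  simp only [← relationMap_apply, ← Submodule.Quotient.mk_eq_zero (Mmod a)]
  rw [← Set.image_image (relationMap a M) monov, Submodule.span_image, Submodule.mem_map]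
  constructor
  · rintro ⟨p, hp, hpiv⟩
    obtain ⟨hd, hall⟩ := (isPivot_iff_coeff s p i d).1 hpiv
    refine ⟨monov (d, i) - ((p i).coeff d)⁻¹ • p, (mem_span_monov_iff _ _).2 fun j k hk => ?_, by
      simp [hp]⟩
    rw [Pi.sub_apply, Polynomial.coeff_sub, coeff_monov, Pi.smul_apply, Polynomial.coeff_smul,
      smul_eq_mul] at hk
    by_cases heq : (k, j) = (d, i)
    · obtain ⟨rfl, rfl⟩ := Prod.mk.inj heq
      simp [hd] at hk
    · rw [if_neg heq] at hk
      exact (hall j k fun h => hk (by simp [h])).resolve_right heq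
  · rintro ⟨q, hq, hφ⟩
    rw [mem_span_monov_iff] at hq
    refine ⟨monov (d, i) - q, by rw [map_sub, hφ, sub_self],
      (isPivot_iff_coeff s _ i d).2 ⟨?_, fun j k hk => ?_⟩⟩
    · have hqd : (q i).coeff d = 0 := by
        by_contra h
        exact not_sTopLT_self s _ (hq i d h)
      simp [coeff_monov, hqd]
    · by_cases heq : (k, j) = (d, i)
      · exact Or.inr heq
      · refine Or.inl (hq j k fun h => hk ?_)
        rw [Pi.sub_apply, Polynomial.coeff_sub, coeff_monov, if_neg heq, h, sub_zero]
end
end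

section
/- Let K be a field, m ≥ n ≥ 1, a_1,...,a_n ∈ K[x] nonzero with a_n | ... | a_1 and f_i = deg(a_i) (so f_1 ≥ ... ≥ f_n), extended by f_{n+1} = ... = f_m = 0, and M = ⟨a_i(x)·ε'_i⟩ ⊆ K[x]^n. Let d = (d_1,...,d_m) ∈ N^m be non-increasing. Then there exists a matrix M ∈ K[x]^{m×n} such that the family {x^i·(ε_j M) mod M : 0 ≤ i < d_j, 1 ≤ j ≤ m} is K-linearly independent in K[x]^n/M if and only if Σ_{i=1}^l d_i ≤ Σ_{i=1}^l f_i for all 1 ≤ l ≤ m. -/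
open Polynomial

noncomputable section

section PolynomialCombinations

variable {K Q ι : Type*} [Field K] [AddCommGroup Q] [Module K[X] Q] [Fintype ι]

/-- The only polynomial relation `∑ j, p j • r j = 0` with `deg (p j) < g j` is the trivial one. -/
def DegreeIndependent (r : ι → Q) (g : ι → ℕ) : Prop :=
  ∀ p : ι → K[X], (∀ j, (p j).degree < g j) → ∑ j, p j • r j = 0 → p = 0

lemma DegreeIndependent.mono {r : ι → Q} {g g' : ι → ℕ}
    (h : DegreeIndependent (K := K) r g) (hg : ∀ j, g' j ≤ g j) :
    DegreeIndependent (K := K) r g' :=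
  fun p hp => h p fun j => (hp j).trans_le (by exact_mod_cast hg j)

lemma DegreeIndependent.linearIndependent [Module K Q] [IsScalarTower K K[X] Q]
    {r : ι → Q} {g : ι → ℕ} (h : DegreeIndependent (K := K) r g) :
    LinearIndependent K (fun p : Σ j, Fin (g j) => (X ^ (p.2 : ℕ) : K[X]) • r p.1) := by
  rw [Fintype.linearIndependent_iff]
  intro c hc
  have key := h (fun j => ∑ s : Fin (g j), C (c ⟨j, s⟩) * X ^ (s : ℕ))
    (fun j => degree_sum_fin_lt _) (by
      rw [← hc, Fintype.sum_sigma]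
      refine Finset.sum_congr rfl fun j _ => ?_
      rw [Finset.sum_smul]
      refine Finset.sum_congr rfl fun s _ => ?_
      rw [← smul_eq_C_mul, smul_assoc])
  rintro ⟨j, s⟩
  have := congrArg (fun q : K[X] => q.coeff s) (congrFun key j)
  simpa [finsetSum_coeff, coeff_X_pow, Fin.val_inj] using this

/-- One unit of degree can be moved from a longer chain to a shorter one. -/
lemma DegreeIndependent.exists_transfer {r : ι → Q} {g g' : ι → ℕ}
    (h : DegreeIndependent (K := K) r g) {i j : ι} (hij : i ≠ j) (hlt : g j < g i)
    (hi : g' i + 1 = g i) (hj : g' j = g j + 1) (hk : ∀ k, k ≠ i → k ≠ j → g' k = g k) :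
    ∃ r' : ι → Q, DegreeIndependent (K := K) r' g' := by
  classical
  by_cases h0 : DegreeIndependent (K := K) r g'
  · exact ⟨r, h0⟩
  have hle : ∀ k, k ≠ j → g' k ≤ g k := fun k hkj => by
    by_cases hki : k = i
    · subst hki; omega
    · exact (hk k hki hkj).le
  have of_coeff : ∀ p : ι → K[X], (∀ k, k ≠ j → (p k).degree < g k) →
      (p j).degree < g' j → (p j).coeff (g j) = 0 → ∑ k, p k • r k = 0 → p = 0 := by
    intro p h1 h2 h3 h4
    refine h p (fun k => ?_) h4
    by_cases hkj : k = j
    · subst hkj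
      rw [degree_lt_iff_coeff_zero] at h2 ⊢
      intro s hs
      rcases hs.eq_or_lt with rfl | hs
      · exact h3
      · exact h2 s (by omega)
    · exact h1 k hkj
  unfold DegreeIndependent at h0
  push Not at h0
  obtain ⟨p, hp, hpr, hp0⟩ := h0
  have hp' : ∀ k, k ≠ j → (p k).degree < g k := fun k hkj =>
    (hp k).trans_le (by exact_mod_cast hle k hkj)
  have hb : (p j).coeff (g j) ≠ 0 := fun hb => hp0 (of_coeff p hp' (hp j) hb hpr)
  set e := g i - g j - 1 with he
  refine ⟨Function.update r j (r j + (X ^ e : K[X]) • r i), fun q hq hqr => ?_⟩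
  set q' : ι → K[X] := q + Pi.single i (q j * X ^ e) with hq'
  have hq'r : ∑ k, q' k • r k = 0 := by
    rw [← hqr, ← Finset.add_sum_erase _ _ (Finset.mem_univ j),
      ← Finset.add_sum_erase (a := j) (f := fun k => q k • _) _ (Finset.mem_univ j)]
    have hE : i ∈ Finset.univ.erase j := by simp [hij]
    rw [← Finset.add_sum_erase _ _ hE, ← Finset.add_sum_erase (a := i) (f := fun k => q k • _) _ hE]
    have hrest : ∑ k ∈ (Finset.univ.erase j).erase i, q' k • r k =
        ∑ k ∈ (Finset.univ.erase j).erase i,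
          q k • Function.update r j (r j + (X ^ e : K[X]) • r i) k := by
      refine Finset.sum_congr rfl fun k hk => ?_
      simp only [Finset.mem_erase] at hk
      simp [hq', hk.1, hk.2.1]
    rw [hrest]
    simp [hq', hij, hij.symm, add_smul, smul_add, mul_smul]
    abel
  have hq'j : q' j = q j := by simp [hq', hij.symm]
  have hq'i : q' i = q i + q j * X ^ e := by simp [hq']
  have hqj := (degree_lt_iff_coeff_zero _ _).1 (hq j)
  have hqi := (degree_lt_iff_coeff_zero _ _).1 (hq i)
  have hpi := (degree_lt_iff_coeff_zero _ _).1 (hp i)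
  have hq'deg : ∀ k, k ≠ j → (q' k).degree < g k := by
    intro k hkj
    by_cases hki : k = i
    · subst hki
      rw [hq'i, degree_lt_iff_coeff_zero]
      intro s hs
      rw [coeff_add, coeff_mul_X_pow', if_pos (by omega), hqi s (by omega),
        hqj (s - e) (by omega), add_zero]
    · have : q' k = q k := by simp [hq', hki]
      rw [this]
      exact (hq k).trans_le (by exact_mod_cast hle k hkj)
  set b := (p j).coeff (g j)
  set c := (q j).coeff (g j) with hc
  have hz : (fun k => C b * q' k - C c * p k) = 0 := by
    refine of_coeff _ (fun k hkj => ?_) ?_ ?_ ?_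
    · have h1 := (degree_lt_iff_coeff_zero _ _).1 (hq'deg k hkj)
      have h2 := (degree_lt_iff_coeff_zero _ _).1 (hp' k hkj)
      rw [degree_lt_iff_coeff_zero]
      intro s hs
      simp [h1 s hs, h2 s hs]
    · have h2 := (degree_lt_iff_coeff_zero _ _).1 (hp j)
      rw [degree_lt_iff_coeff_zero]
      intro s hs
      simp [hq'j, hqj s hs, h2 s hs]
    · simp only [coeff_sub, coeff_C_mul, hq'j]
      ring
    · simp only [sub_smul, mul_smul, Finset.sum_sub_distrib, ← Finset.smul_sum, hq'r, hpr]
      simp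
  have hc0 : c = 0 := by
    have := congrArg (fun u : K[X] => u.coeff (g i - 1)) (congrFun hz i)
    simp only [coeff_sub, coeff_C_mul, hq'i, coeff_add, coeff_mul_X_pow', Pi.zero_apply,
      coeff_zero] at this
    rw [hqi _ (by omega), hpi _ (by omega), if_pos (by omega),
      show g i - 1 - e = g j by omega, ← hc] at this
    simpa [hb] using this
  have hq'0 : q' = 0 := of_coeff q' hq'deg (hq'j ▸ hq j) (by rw [hq'j, ← hc, hc0]) hq'r
  have hqj0 : q j = 0 := by rw [← hq'j, hq'0]; rfl
  simpa [hq', hqj0] using hq'0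

end PolynomialCombinations

/-- A property of sequences that passes to smaller sequences and is stable under moving a unit
from a larger entry to a smaller one passes to weakly majorized nonincreasing sequences. -/
lemma of_sum_range_le {m : ℕ} {S : (ℕ → ℕ) → Prop} {d : ℕ → ℕ}
    (hd : ∀ i j : ℕ, i ≤ j → j < m → d j ≤ d i)
    (mono : ∀ g g' : ℕ → ℕ, (∀ k < m, g' k ≤ g k) → S g → S g')
    (transfer : ∀ (g g' : ℕ → ℕ) (i j : ℕ), i < m → j < m → i ≠ j → g j < g i →
      g' i + 1 = g i → g' j = g j + 1 → (∀ k, k ≠ i → k ≠ j → g' k = g k) → S g → S g')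
    {g : ℕ → ℕ} (hg : S g)
    (hsum : ∀ l ≤ m, ∑ i ∈ Finset.range l, d i ≤ ∑ i ∈ Finset.range l, g i) : S d := by
  induction hN : ∑ k ∈ Finset.range m, (d k - g k) using Nat.strong_induction_on
    generalizing g with
  | _ N ih =>
  by_cases hle : ∀ k < m, d k ≤ g k
  · exact mono g d hle hg
  push Not at hle
  classical
  let j := Nat.find hle
  obtain ⟨hjm, hj⟩ : j < m ∧ g j < d j := Nat.find_spec hle
  have hbelow : ∀ k < j, d k ≤ g k := fun k hk => by
    have := Nat.find_min hle hk
    push Not at this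
    exact this (by omega)
  obtain ⟨i, hij, hi⟩ : ∃ i < j, d i < g i := by
    by_contra! hcon
    have h1 := hsum (j + 1) hjm
    rw [Finset.sum_range_succ, Finset.sum_range_succ] at h1
    have h2 : ∑ k ∈ Finset.range j, g k ≤ ∑ k ∈ Finset.range j, d k :=
      Finset.sum_le_sum fun k hk => hcon k (Finset.mem_range.1 hk)
    omega
  have hdij := hd i j hij.le hjm
  let g' := Function.update (Function.update g i (g i - 1)) j (g j + 1)
  have hg'i : g' i = g i - 1 := by simp [g', hij.ne]
  have hg'j : g' j = g j + 1 := by simp [g']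
  have hg'k : ∀ k, k ≠ i → k ≠ j → g' k = g k := fun k h1 h2 => by simp [g', h1, h2]
  refine ih (∑ k ∈ Finset.range m, (d k - g' k)) ?_
    (transfer g g' i j (by omega) hjm hij.ne (by omega) (by omega) hg'j hg'k hg) ?_ rfl
  · rw [← hN]
    refine Finset.sum_lt_sum (fun k _ => ?_) ⟨j, Finset.mem_range.2 hjm, by omega⟩
    rcases eq_or_ne k i with rfl | h1
    · omega
    rcases eq_or_ne k j with rfl | h2
    · omega
    rw [hg'k k h1 h2]
  · intro l hl
    by_cases hlj : l ≤ j
    · refine Finset.sum_le_sum fun k hk => ?_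
      have hk := Finset.mem_range.1 hk
      have := hbelow k (by omega)
      rcases eq_or_ne k i with rfl | h1
      · omega
      rwa [hg'k k h1 (by omega)]
    · have hjl : j ∈ Finset.range l := Finset.mem_range.2 (by omega)
      have hil : i ∈ (Finset.range l).erase j := by
        simp only [Finset.mem_erase, Finset.mem_range]; omega
      have hrest : ∑ k ∈ ((Finset.range l).erase j).erase i, g' k =
          ∑ k ∈ ((Finset.range l).erase j).erase i, g k :=
        Finset.sum_congr rfl fun k hk => by
          simp only [Finset.mem_erase] at hk
          exact hg'k k hk.1 hk.2.1
      have e1 := Finset.add_sum_erase _ g' hjl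
      have e2 := Finset.add_sum_erase _ g hjl
      have e3 := Finset.add_sum_erase _ g' hil
      have e4 := Finset.add_sum_erase _ g hil
      have := hsum l hl
      omega

/-- In a module generated by elements `e i` killed by a divisibility chain `A 0, A 1, ...`,
the submodule generated by `l` elements has dimension at most the sum of the degrees of
`A 0, ..., A (l - 1)`. -/
lemma exists_submodule_finrank_le {K Q : Type*} [Field K] [AddCommGroup Q] [Module K Q]
    [Module K[X] Q] [IsScalarTower K K[X] Q] {A : ℕ → K[X]} (hA : ∀ i, A i ≠ 0)
    (hdvd : ∀ i j, i ≤ j → A j ∣ A i) {e : ℕ → Q} (he : ∀ i, A i • e i = 0)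
    (hspan : Submodule.span K[X] (Set.range e) = ⊤) {l : ℕ} (r : Fin l → Q) :
    ∃ W : Submodule K Q, FiniteDimensional K W ∧
      Module.finrank K W ≤ ∑ i ∈ Finset.range l, (A i).natDegree ∧
      ∀ (j : Fin l) (p : K[X]), p • r j ∈ W := by
  set b := A l with hb
  let gen (n : ℕ) (v : Q) : degreeLT K n →ₗ[K] Q :=
    (LinearMap.toSpanSingleton K[X] Q v).restrictScalars K ∘ₗ (degreeLT K n).subtype
  let Φ : ((j : Fin l) → degreeLT K b.natDegree ×
      degreeLT K ((A j).natDegree - b.natDegree)) →ₗ[K] Q :=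
    ∑ j : Fin l, ((gen _ (r j)).coprod (gen _ (b • e j))) ∘ₗ LinearMap.proj j
  have hfin (n : ℕ) : FiniteDimensional K (degreeLT K n) :=
    (degreeLTEquiv K n).symm.finiteDimensional
  have hrank (n : ℕ) : Module.finrank K (degreeLT K n) = n := by
    rw [(degreeLTEquiv K n).finrank_eq, Module.finrank_fin_fun]
  have hΦ (x) : Φ x = ∑ j, ((x j).1.1 • r j + (x j).2.1 • b • e j) := by
    simp [Φ, gen]
  have mod_lt (p : K[X]) {q : K[X]} (hq : q ≠ 0) : p % q ∈ degreeLT K q.natDegree := by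
    rw [mem_degreeLT, ← degree_eq_natDegree hq]
    exact EuclideanDomain.mod_lt p hq
  have hr (j : Fin l) {p : K[X]} (hp : p ∈ degreeLT K b.natDegree) :
      p • r j ∈ LinearMap.range Φ := by
    refine ⟨Pi.single j (⟨p, hp⟩, 0), ?_⟩
    rw [hΦ, Finset.sum_eq_single j]
    · simp
    · intro k _ hk; simp [hk]
    · simp
  have hbe (i : ℕ) (p : K[X]) : p • b • e i ∈ LinearMap.range Φ := by
    by_cases hi : i < l
    · obtain ⟨c, hc⟩ := hdvd i l hi.le
      have hc0 : c ≠ 0 := by rintro rfl; exact hA i (by simpa using hc)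
      have hdeg : c.natDegree = (A i).natDegree - b.natDegree := by
        rw [hc, natDegree_mul (hA l) hc0, hb]; omega
      have hred : p • b • e i = (p % c) • b • e i := by
        conv_lhs => rw [← EuclideanDomain.mod_add_div p c]
        rw [add_smul, add_eq_left, smul_smul, show c * (p / c) * b = (p / c) * A i by
          rw [hc, hb]; ring, mul_smul, he, smul_zero]
      rw [hred]
      refine ⟨Pi.single ⟨i, hi⟩ (0, ⟨p % c, hdeg ▸ mod_lt p hc0⟩), ?_⟩
      rw [hΦ, Finset.sum_eq_single ⟨i, hi⟩]
      · simp
      · intro k _ hk; simp [hk]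
      · simp
    · obtain ⟨c, hc⟩ := hdvd l i (by omega)
      have hz : b • e i = 0 := by rw [hb, hc, mul_comm, mul_smul, he, smul_zero]
      rw [hz, smul_zero]
      exact zero_mem _
  have hbQ (v : Q) : ∀ p : K[X], p • b • v ∈ LinearMap.range Φ := by
    have hv : v ∈ Submodule.span K[X] (Set.range e) := hspan ▸ Submodule.mem_top
    induction hv using Submodule.span_induction with
    | mem x hx => obtain ⟨i, rfl⟩ := hx; exact hbe i
    | zero => simp
    | add x y _ _ hx hy =>
      intro p
      rw [smul_add, smul_add]
      exact add_mem (hx p) (hy p)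
    | smul c x _ hx =>
      intro p
      rw [smul_comm b c x, smul_smul]
      exact hx _
  refine ⟨LinearMap.range Φ, inferInstance, ?_, fun j p => ?_⟩
  · refine (LinearMap.finrank_range_le Φ).trans ?_
    rw [Module.finrank_pi_fintype, Finset.sum_range]
    refine Finset.sum_le_sum fun j _ => ?_
    rw [Module.finrank_prod, hrank, hrank]
    have : b.natDegree ≤ (A j).natDegree := natDegree_le_of_dvd (hdvd j l j.2.le) (hA j)
    omega
  · have hp : p • r j = (p % b) • r j + (p / b) • b • r j := by
      rw [smul_smul, mul_comm, ← add_smul, EuclideanDomain.mod_add_div]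
    rw [hp]
    exact add_mem (hr j (mod_lt p (hA l))) (hbQ (r j) _)

lemma dvd_of_mem_Mmod {K : Type*} [Field K] {n : ℕ} {a v : Fin n → K[X]} (hv : v ∈ Mmod a)
    (i : Fin n) : a i ∣ v i := by
  have hle : Mmod a ≤ Submodule.pi Set.univ fun i => Ideal.span {a i} := by
    rw [Mmod, Submodule.span_le]
    rintro _ ⟨j, rfl⟩ i -
    rcases eq_or_ne i j with rfl | h
    · simp
    · simp [h]
  exact Ideal.mem_span_singleton.1 (hle hv i trivial)

lemma pmul_single {K : Type*} [Field K] {m n : ℕ} (M : Matrix (Fin m) (Fin n) K[X])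
    (j : Fin m) (p : K[X]) : pmul M (Pi.single j p) = p • M j := by
  ext1 k
  simp [pmul, Pi.single_apply]

/-- The class of the `j`-th canonical vector, zero for `n ≤ j`. -/
def quotientBasis {K : Type*} [Field K] {n : ℕ} (a : Fin n → K[X]) (j : ℕ) :
    (Fin n → K[X]) ⧸ Mmod a :=
  (Mmod a).mkQ fun i => if (i : ℕ) = j then 1 else 0

lemma span_quotientBasis {K : Type*} [Field K] {n : ℕ} (a : Fin n → K[X]) :
    Submodule.span K[X] (Set.range (quotientBasis a)) = ⊤ := by
  rw [eq_top_iff]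
  rintro x -
  obtain ⟨v, rfl⟩ := (Mmod a).mkQ_surjective x
  have hv : (Mmod a).mkQ v = ∑ i : Fin n, v i • quotientBasis a i := by
    simp only [quotientBasis, ← map_smul, ← map_sum]
    congr 1
    ext1 k
    simp [Fin.val_inj]
  rw [hv]
  exact sum_mem fun i _ => Submodule.smul_mem _ _ (Submodule.subset_span ⟨i, rfl⟩)

lemma smul_quotientBasis {K : Type*} [Field K] {n : ℕ} (a : Fin n → K[X]) (i : Fin n) :
    a i • quotientBasis a i = 0 := by
  rw [quotientBasis, ← map_smul, Submodule.mkQ_apply, Submodule.Quotient.mk_eq_zero]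
  refine (Submodule.subset_span ⟨i, ?_⟩ : _ ∈ Mmod a)
  ext1 k
  simp [Pi.single_apply, Fin.ext_iff]

lemma quotientBasis_of_le {K : Type*} [Field K] {n : ℕ} (a : Fin n → K[X]) {j : ℕ}
    (hj : n ≤ j) : quotientBasis a j = 0 := by
  have : (fun i : Fin n => if (i : ℕ) = j then (1 : K[X]) else 0) = 0 := by
    ext1 i
    simp [(i.2.trans_le hj).ne]
  rw [quotientBasis, this, map_zero]

lemma degreeIndependent_quotientBasis {K : Type*} [Field K] {m n : ℕ} (hmn : n ≤ m)
    {a : Fin n → K[X]} (ha : ∀ i, a i ≠ 0) {f : ℕ → ℕ}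
    (hf : ∀ i : Fin n, f (i : ℕ) = (a i).natDegree) (hf0 : ∀ i, n ≤ i → f i = 0) :
    DegreeIndependent (K := K) (fun j : Fin m => quotientBasis a j) fun j : Fin m => f j := by
  intro p hp hsum
  have hmem : (fun i : Fin n => p (i.castLE hmn)) ∈ Mmod a := by
    rw [← Submodule.Quotient.mk_eq_zero, ← Submodule.mkQ_apply, ← hsum]
    simp only [quotientBasis, ← map_smul, ← map_sum]
    congr 1
    ext1 k
    rw [Finset.sum_apply, Finset.sum_eq_single (k.castLE hmn)]
    · simp
    · intro j _ hj
      have : (k : ℕ) ≠ j := fun h => hj (Fin.ext h.symm)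
      simp [this]
    · simp
  ext1 j
  by_cases hj : (j : ℕ) < n
  · have hd := dvd_of_mem_Mmod hmem ⟨j, hj⟩
    refine eq_zero_of_dvd_of_degree_lt hd ?_
    rw [degree_eq_natDegree (ha _), ← hf]
    exact hp j
  · have := hp j
    simpa [hf0 j (by omega), Nat.WithBot.lt_zero_iff] using this

/-- **Achievable independent monomial families** (Theorem `thm:clement`).
Let `f_1 ≥ ... ≥ f_n` be the degrees of the invariants `a_1,...,a_n` (with `a_n | ... | a_1`),
extended by `f_{n+1} = ... = f_m = 0`, and let `d ∈ ℕ^m` be non-increasing. There exists a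
matrix `M ∈ K[x]^{m×n}` such that the family `{x^i (ε_j M) mod M : i < d_j}` is K-linearly
independent in `K[x]^n/M` iff `Σ_{i=1}^l d_i ≤ Σ_{i=1}^l f_i` for all `1 ≤ l ≤ m`. -/
theorem exists_matrix_indep_iff {K : Type*} [Field K] {m n : ℕ} (hmn : n ≤ m) (hn : 0 < n)
    (a : Fin n → Polynomial K) (ha : ∀ i, a i ≠ 0)
    (hdvd : ∀ i j : Fin n, i ≤ j → a j ∣ a i)
    (f : ℕ → ℕ) (hf : ∀ i : Fin n, f (i : ℕ) = (a i).natDegree)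
    (hf0 : ∀ i, n ≤ i → f i = 0)
    (d : ℕ → ℕ) (hd : ∀ i j : ℕ, i ≤ j → j < m → d j ≤ d i) :
    (∃ M : Matrix (Fin m) (Fin n) (Polynomial K),
      LinearIndependent K (fun p : Σ j : Fin m, Fin (d (j : ℕ)) =>
        (Submodule.Quotient.mk (pmul M (Pi.single p.1 (X ^ (p.2 : ℕ)))) :
          (Fin n → Polynomial K) ⧸ Mmod a)))
      ↔ ∀ l : ℕ, 1 ≤ l → l ≤ m →
          ∑ i ∈ Finset.range l, d i ≤ ∑ i ∈ Finset.range l, f i := by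
  constructor
  · rintro ⟨M, hM⟩ l - hlm
    simp only [pmul_single, Submodule.Quotient.mk_smul] at hM
    let A : ℕ → K[X] := fun i => if h : i < n then a ⟨i, h⟩ else 1
    have hA_deg (i : ℕ) : (A i).natDegree = f i := by
      by_cases h : i < n
      · simp [A, h, ← hf]
      · simp [A, h, hf0 i (by omega)]
    obtain ⟨W, hW, hWle, hmem⟩ := exists_submodule_finrank_le (K := K) (A := A)
      (e := quotientBasis a)
      (fun i => by
        by_cases h : i < n
        · simp [A, h, ha]
        · simp [A, h])
      (fun i j hij => by
        by_cases h : j < n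
        · simpa [A, h, hij.trans_lt h] using hdvd _ _ (Fin.mk_le_mk.2 hij)
        · simp [A, h])
      (fun i => by
        by_cases h : i < n
        · simpa [A, h] using smul_quotientBasis a ⟨i, h⟩
        · simp [quotientBasis_of_le a (not_lt.1 h)])
      (span_quotientBasis a)
      (fun j : Fin l => (Submodule.Quotient.mk (M (j.castLE hlm)) : _ ⧸ Mmod a))
    let emb : (Σ j : Fin l, Fin (d j)) → Σ j : Fin m, Fin (d j) :=
      fun p => ⟨p.1.castLE hlm, p.2⟩
    have hemb : Function.Injective emb := by
      rintro ⟨⟨j, hj⟩, s⟩ ⟨⟨k, hk⟩, t⟩ h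
      simp only [emb, Sigma.mk.injEq, Fin.castLE_mk, Fin.mk.injEq] at h
      obtain ⟨rfl, h⟩ := h
      rw [eq_of_heq h]
    have hlin := hM.comp emb hemb
    have hlinW : LinearIndependent K (fun p : Σ j : Fin l, Fin (d j) =>
        (⟨_, hmem p.1 (X ^ (p.2 : ℕ))⟩ : W)) :=
      LinearIndependent.of_comp W.subtype hlin
    have := hlinW.fintype_card_le_finrank.trans hWle
    simpa [Finset.sum_range, hA_deg] using this
  · intro hsum
    obtain ⟨r, hr⟩ := of_sum_range_le
      (S := fun g => ∃ r : Fin m → (Fin n → K[X]) ⧸ Mmod a,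
        DegreeIndependent (K := K) r fun j => g j) hd
      (fun g g' hle ⟨r, hr⟩ => ⟨r, hr.mono fun j => hle j j.2⟩)
      (fun g g' i j hi hj hij hlt hgi hgj hgk ⟨r, hr⟩ =>
        hr.exists_transfer (i := ⟨i, hi⟩) (j := ⟨j, hj⟩) (by simpa using hij) hlt hgi hgj
          fun k h1 h2 => hgk k (fun h => h1 (Fin.ext h)) fun h => h2 (Fin.ext h))
      ⟨_, degreeIndependent_quotientBasis hmn ha hf hf0⟩
      (fun l hl => by
        rcases l.eq_zero_or_pos with rfl | h
        · simp
        · exact hsum l h hl)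
    choose M hM using fun j => (Mmod a).mkQ_surjective (r j)
    refine ⟨Matrix.of M, ?_⟩
    simp only [pmul_single, Submodule.Quotient.mk_smul]
    rw [← funext hM] at hr
    exact hr.linearIndependent
end
end

section
/- Let K be a field, a_1,...,a_n ∈ K[x] nonzero with a_n | ... | a_1 and f_i = deg(a_i) (so f_1 ≥ ... ≥ f_n), and K = K[x]^n/⟨a_i(x)·ε'_i⟩. If N is a K[x]-submodule of K generated by l elements (equivalently, of rank l as a quotient-of-free module), then dim_K N ≤ f_1 + ... + f_l (where f_j = 0 for j > n). -/
open Polynomial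

noncomputable section

theorem mem_Mmod_of_forall_dvd {K : Type*} [Field K] {n : ℕ} {a w : Fin n → K[X]}
    (h : ∀ i, a i ∣ w i) : w ∈ Mmod a := by
  rw [← Finset.univ_sum_single w]
  refine Submodule.sum_mem _ fun i _ => ?_
  obtain ⟨c, hc⟩ := h i
  have : Pi.single i (w i) = c • (Pi.single i (a i) : Fin n → K[X]) := by
    rw [← Pi.single_smul, smul_eq_mul, hc, mul_comm]
  rw [this]
  exact Submodule.smul_mem _ _ (Submodule.subset_span ⟨i, rfl⟩)

/-- A cyclic `K[X]`-module killed by a nonzero polynomial `p` has dimension at most `deg p`. -/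
theorem rank_span_singleton_le_natDegree {K : Type*} [Field K] {Q : Type*} [AddCommGroup Q]
    [Module K[X] Q] [Module K Q] [IsScalarTower K K[X] Q] {p : K[X]} (hp : p ≠ 0) {q : Q}
    (hq : p • q = 0) :
    Module.rank K ((Submodule.span K[X] {q}).restrictScalars K) ≤ (p.natDegree : Cardinal) := by
  let φ : (Fin p.natDegree → K) →ₗ[K] Q :=
    ((LinearMap.toSpanSingleton K[X] Q q).restrictScalars K ∘ₗ
      (degreeLT K p.natDegree).subtype) ∘ₗ (degreeLTEquiv K p.natDegree).symm.toLinearMap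
  have hle : (Submodule.span K[X] {q}).restrictScalars K ≤ LinearMap.range φ := by
    intro y hy
    obtain ⟨r, rfl⟩ := Submodule.mem_span_singleton.1 hy
    have hr : r % p ∈ degreeLT K p.natDegree := by
      rw [mem_degreeLT, ← degree_eq_natDegree hp]
      exact EuclideanDomain.mod_lt r hp
    refine ⟨degreeLTEquiv K p.natDegree ⟨r % p, hr⟩, ?_⟩
    have hrq : r • q = (r % p) • q := by
      conv_lhs => rw [← EuclideanDomain.div_add_mod r p, add_smul, mul_comm, mul_smul, hq,
        smul_zero, zero_add]
    simp [φ, hrq]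
  have hfin : Module.Finite K ((Submodule.span K[X] {q}).restrictScalars K) :=
    Submodule.finiteDimensional_of_le hle
  rw [← Module.finrank_eq_rank, Nat.cast_le]
  calc _ ≤ Module.finrank K (LinearMap.range φ) := Submodule.finrank_mono hle
    _ ≤ Module.finrank K (Fin p.natDegree → K) := LinearMap.finrank_range_le φ
    _ = p.natDegree := by simp

/-- A linear functional on a submodule over a principal ideal domain splits off a vector, lowering
the rank of the kernel when the functional does not vanish. -/
theorem exists_le_span_singleton_sup_inf_ker {R V : Type*} [CommRing R] [IsDomain R]
    [IsPrincipalIdealRing R] [AddCommGroup V] [Module R V] (S : Submodule R V)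
    [Module.Finite R S] (π : V →ₗ[R] R) (hS : ¬ S ≤ LinearMap.ker π) :
    ∃ v ∈ S, S ≤ Submodule.span R {v} ⊔ (S ⊓ LinearMap.ker π) ∧
      Module.finrank R (S ⊓ LinearMap.ker π : Submodule R V) + 1 ≤ Module.finrank R S := by
  obtain ⟨c, hc⟩ := (IsPrincipalIdealRing.principal (S.map π)).principal
  obtain ⟨v, hv, rfl⟩ : c ∈ S.map π := hc ▸ Submodule.mem_span_singleton_self c
  refine ⟨v, hv, fun w hw => ?_, ?_⟩
  · obtain ⟨r, hr⟩ := Submodule.mem_span_singleton.1 (hc ▸ Submodule.mem_map_of_mem hw)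
    refine Submodule.mem_sup.2 ⟨r • v, Submodule.smul_mem _ _ (Submodule.mem_span_singleton_self v),
      w - r • v, ⟨S.sub_mem hw (S.smul_mem r hv), ?_⟩, by abel⟩
    rw [SetLike.mem_coe, LinearMap.mem_ker, map_sub, map_smul, hr, sub_self]
  · have hrn := Submodule.finrank_quotient_add_finrank (LinearMap.ker (π ∘ₗ S.subtype))
    rw [(π ∘ₗ S.subtype).quotKerEquivRange.finrank_eq] at hrn
    have hker : (LinearMap.ker (π ∘ₗ S.subtype)).map S.subtype = S ⊓ LinearMap.ker π := by
      rw [LinearMap.ker_comp, Submodule.map_comap_subtype]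
    have hfk : Module.finrank R (S ⊓ LinearMap.ker π : Submodule R V) =
        Module.finrank R (LinearMap.ker (π ∘ₗ S.subtype)) := by
      rw [← hker]
      exact (Submodule.equivMapOfInjective _ S.injective_subtype _).finrank_eq.symm
    have hpos : 0 < Module.finrank R (LinearMap.range (π ∘ₗ S.subtype)) := by
      have : Nontrivial (LinearMap.range (π ∘ₗ S.subtype)) := by
        rw [Submodule.nontrivial_iff_ne_bot]
        intro h
        refine hS fun w hw => ?_
        exact LinearMap.congr_fun (LinearMap.range_eq_bot.1 h) ⟨w, hw⟩
      exact Module.finrank_pos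
    omega

theorem rank_map_mkQ_le {K : Type*} [Field K] {n : ℕ} {a : Fin n → K[X]} (ha : ∀ i, a i ≠ 0)
    (hdvd : ∀ i j : Fin n, i ≤ j → a j ∣ a i) {f : ℕ → ℕ} (hanti : Antitone f)
    (hf : ∀ i : Fin n, f (i : ℕ) = (a i).natDegree) (d k l : ℕ) (hk : n ≤ k + d)
    (S : Submodule K[X] (Fin n → K[X])) (hS : ∀ v ∈ S, ∀ i : Fin n, (i : ℕ) < k → v i = 0)
    (hl : Module.finrank K[X] S ≤ l) :
    Module.rank K ((S.map (Mmod a).mkQ).restrictScalars K) ≤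
      ((∑ i ∈ Finset.range l, f (k + i) : ℕ) : Cardinal) := by
  induction d generalizing k l S with
  | zero =>
    have : S = ⊥ := (Submodule.eq_bot_iff S).2 fun v hv => funext fun i => hS v hv i (by omega)
    rw [this, Submodule.map_bot, Submodule.restrictScalars_bot, rank_bot]
    exact zero_le
  | succ d ih =>
    by_cases hkn : k < n
    swap
    · exact ih k l (by omega) S hS hl
    let π : (Fin n → K[X]) →ₗ[K[X]] K[X] := LinearMap.proj ⟨k, hkn⟩
    have step : ∀ T ≤ S, T ≤ LinearMap.ker π → ∀ v ∈ T, ∀ i : Fin n, (i : ℕ) < k + 1 → v i = 0 := by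
      intro T hTS hT v hv i hi
      rcases Nat.lt_succ_iff_lt_or_eq.1 hi with h | h
      · exact hS v (hTS hv) i h
      · obtain rfl : i = ⟨k, hkn⟩ := Fin.ext h
        exact hT hv
    by_cases hker : S ≤ LinearMap.ker π
    · refine (ih (k + 1) l (by omega) S (step S le_rfl hker) hl).trans ?_
      exact_mod_cast Finset.sum_le_sum fun i _ => hanti (by omega)
    obtain ⟨v, hv, hle, hrank⟩ := exists_le_span_singleton_sup_inf_ker S π hker
    obtain ⟨l, rfl⟩ : ∃ m, l = m + 1 := ⟨l - 1, by omega⟩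
    have hrest := ih (k + 1) l (by omega) _ (step _ inf_le_left inf_le_right) (by omega)
    have hkill : a ⟨k, hkn⟩ • (Mmod a).mkQ v = 0 := by
      rw [← map_smul, Submodule.mkQ_apply, Submodule.Quotient.mk_eq_zero]
      refine mem_Mmod_of_forall_dvd fun i => ?_
      rcases lt_or_ge (i : ℕ) k with h | h
      · simp [hS v hv i h]
      · exact (hdvd ⟨k, hkn⟩ i h).mul_right _
    have hcyc := rank_span_singleton_le_natDegree (ha ⟨k, hkn⟩) hkill
    have hmap : (S.map (Mmod a).mkQ).restrictScalars K ≤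
        (Submodule.span K[X] {(Mmod a).mkQ v}).restrictScalars K ⊔
          ((S ⊓ LinearMap.ker π).map (Mmod a).mkQ).restrictScalars K := by
      rw [← Submodule.restrictScalars_sup, ← Set.image_singleton, ← Submodule.map_span,
        ← Submodule.map_sup]
      exact Submodule.map_mono hle
    calc _ ≤ _ := Submodule.rank_mono hmap
      _ ≤ _ := Submodule.rank_add_le_rank_add_rank _ _
      _ ≤ _ := add_le_add hcyc hrest
      _ = _ := by
        rw [Finset.sum_range_succ', ← hf ⟨k, hkn⟩, ← Nat.cast_add, add_comm]
        simp [add_assoc, add_comm 1]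

/-- **Dimension bound for finitely generated submodules of `K[x]^n/M`**
(Lemma `lm:dimrankr`). If `N` is a `K[x]`-submodule of `K = K[x]^n/⟨a_i ε'_i⟩` generated by
`l` elements, where `a_n | ... | a_1` and `f_i = deg a_i` (with `f_j = 0` for `j > n`),
then `dim_K N ≤ f_1 + ... + f_l`. -/
theorem dim_submodule_le {K : Type*} [Field K] {n : ℕ} (hn : 0 < n)
    (a : Fin n → Polynomial K) (ha : ∀ i, a i ≠ 0)
    (hdvd : ∀ i j : Fin n, i ≤ j → a j ∣ a i)
    (f : ℕ → ℕ) (hf : ∀ i : Fin n, f (i : ℕ) = (a i).natDegree)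
    (hf0 : ∀ i, n ≤ i → f i = 0)
    (l : ℕ)
    (N : Submodule (Polynomial K) ((Fin n → Polynomial K) ⧸ Mmod a))
    (g : Fin l → (Fin n → Polynomial K) ⧸ Mmod a)
    (hgen : Submodule.span (Polynomial K) (Set.range g) = N) :
    Module.finrank K N ≤ ∑ i ∈ Finset.range l, f i := by
  have hanti : Antitone f := antitone_nat_of_succ_le fun i => by
    rcases lt_or_ge (i + 1) n with h | h
    · have h1 := hf ⟨i + 1, h⟩
      have h2 := hf ⟨i, by omega⟩
      simp only at h1 h2
      rw [h1, h2]
      exact natDegree_le_of_dvd (hdvd _ _ (Fin.mk_le_mk.2 i.le_succ)) (ha _)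
    · simp [hf0 (i + 1) h]
  choose g' hg' using fun i => (Mmod a).mkQ_surjective (g i)
  have hN : (Submodule.span K[X] (Set.range g')).map (Mmod a).mkQ = N := by
    rw [Submodule.map_span, ← Set.range_comp, ← hgen]
    exact congrArg _ (congrArg _ (funext hg'))
  have hrank : Module.finrank K[X] (Submodule.span K[X] (Set.range g')) ≤ l := by
    simpa [Set.finrank] using finrank_range_le_card (R := K[X]) g'
  have key := rank_map_mkQ_le ha hdvd hanti hf n 0 l (by omega) _ (by simp) hrank
  rw [hN] at key
  simp only [zero_add] at key
  exact Module.finrank_le_of_rank_le key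
end
end

section
/- Let K be a field, a_1,...,a_n ∈ K[x] nonzero with a_n | ... | a_1 and f_i = deg(a_i) (so f_1 ≥ ... ≥ f_n, with f_j = 0 for j > n), and K = K[x]^n/⟨a_i(x)·ε'_i⟩. Let l ≥ 1, d = (d_1,...,d_l) ∈ N^l, and v_1,...,v_l ∈ K. If the family {x^j·v_i : 0 ≤ j < d_i, 1 ≤ i ≤ l} is K-linearly independent in K, then Σ_{i=1}^l d_i ≤ Σ_{i=1}^l f_i. -/
open Polynomial

noncomputable section

/-- A polynomial of degree less than `m` maps `v` into every `K`-subspace containing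
`v, X • v, ..., X ^ (m - 1) • v`. -/
theorem smul_mem_of_degree_lt {K M : Type*} [Field K] [AddCommGroup M] [Module K M]
    [Module K[X] M] [IsScalarTower K K[X] M] (S : Submodule K M) {p : K[X]} {m : ℕ}
    (hp : p.degree < m) {v : M} (hv : ∀ j < m, (X : K[X]) ^ j • v ∈ S) : p • v ∈ S := by
  rw [p.as_sum_range_C_mul_X_pow, Finset.sum_smul]
  refine S.sum_mem fun j hj => ?_
  rw [← smul_eq_C_mul, smul_assoc]
  by_cases h : j < m
  · exact S.smul_mem _ (hv j h)
  · rw [coeff_eq_zero_of_degree_lt (hp.trans_le (by exact_mod_cast not_lt.mp h)), zero_smul]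
    exact S.zero_mem

/-- In a `K[X]`-module, if `q • v` lies in the `K`-subspace `S` for all multiples `q` of `b ≠ 0`,
and `X ^ j • v ∈ S` for `j < deg b`, then `S` contains every polynomial multiple of `v`. -/
theorem smul_mem_of_mul_mem {K M : Type*} [Field K] [AddCommGroup M] [Module K M]
    [Module K[X] M] [IsScalarTower K K[X] M] (S : Submodule K M) {b : K[X]} (hb : b ≠ 0) {v : M}
    (hmul : ∀ q : K[X], (b * q) • v ∈ S)
    (hv : ∀ j < b.natDegree, (X : K[X]) ^ j • v ∈ S) (p : K[X]) : p • v ∈ S := by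
  rw [← EuclideanDomain.div_add_mod p b, add_smul]
  refine S.add_mem (hmul _) (smul_mem_of_degree_lt S ?_ hv)
  rw [← degree_eq_natDegree hb]
  exact degree_mod_lt p hb

theorem smul_mk_single_eq_zero {K : Type*} [Field K] {n : ℕ} (a : Fin n → K[X]) (i : Fin n)
    {p : K[X]} (hp : a i ∣ p) : p • (Mmod a).mkQ (Pi.single i 1) = 0 := by
  obtain ⟨c, rfl⟩ := hp
  rw [← map_smul, Submodule.mkQ_apply, Submodule.Quotient.mk_eq_zero]
  have h : (a i * c) • (Pi.single i 1 : Fin n → K[X]) = c • Pi.single i (a i) := by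
    rw [← Pi.single_smul, ← Pi.single_smul]
    simp [mul_comm]
  rw [h]
  exact Submodule.smul_mem _ _ (Submodule.subset_span ⟨i, rfl⟩)

/-- The image of multiplication by `b` on `K[X]^n / ⟨a_i ε_i⟩` lies in any `K`-subspace containing
`X ^ j • b • ε_i` for `j < deg a_i - deg b`, provided `b` is comparable to every `a_i`. -/
theorem smul_mem_of_dvd_or_dvd {K : Type*} [Field K] {n : ℕ} {a : Fin n → K[X]}
    (ha : ∀ i, a i ≠ 0) {b : K[X]} (hab : ∀ i, b ∣ a i ∨ a i ∣ b)
    (S : Submodule K ((Fin n → K[X]) ⧸ Mmod a))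
    (hS : ∀ i, ∀ j < (a i).natDegree - b.natDegree,
      (X : K[X]) ^ j • b • (Mmod a).mkQ (Pi.single i 1) ∈ S)
    (y : (Fin n → K[X]) ⧸ Mmod a) : b • y ∈ S := by
  obtain ⟨z, rfl⟩ := (Mmod a).mkQ_surjective y
  rw [pi_eq_sum_univ' z, map_sum, Finset.smul_sum]
  refine S.sum_mem fun i _ => ?_
  rw [map_smul, smul_comm]
  obtain ⟨c, hc⟩ | h := hab i
  · have hbc : b * c ≠ 0 := hc ▸ ha i
    refine smul_mem_of_mul_mem S (right_ne_zero_of_mul hbc) (fun q => ?_) (fun j hj => ?_) _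
    · rw [smul_smul, smul_mk_single_eq_zero a i ⟨q, by rw [hc]; ring⟩]
      exact S.zero_mem
    · refine hS i j ?_
      rw [hc, natDegree_mul (left_ne_zero_of_mul hbc) (right_ne_zero_of_mul hbc)]
      omega
  · rw [smul_mk_single_eq_zero a i h, smul_zero]
    exact S.zero_mem

/-- If `b` is comparable to every `a_i`, then `K`-independent shifts of `l` vectors number at most
`l * deg b + ∑ i, (deg a_i - deg b)`. -/
theorem sum_le_of_linearIndependent_of_dvd_or_dvd {K : Type*} [Field K] {n : ℕ}
    {a : Fin n → K[X]} (ha : ∀ i, a i ≠ 0) {b : K[X]} (hb : b ≠ 0)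
    (hab : ∀ i, b ∣ a i ∨ a i ∣ b) {l : ℕ} {d : Fin l → ℕ}
    {v : Fin l → ((Fin n → K[X]) ⧸ Mmod a)}
    (hindep : LinearIndependent K
      (fun p : Σ i : Fin l, Fin (d i) => (X : K[X]) ^ (p.2 : ℕ) • v p.1)) :
    ∑ i, d i ≤ l * b.natDegree + ∑ i, ((a i).natDegree - b.natDegree) := by
  classical
  let w : (Fin l × Fin b.natDegree) ⊕ (Σ i : Fin n, Fin ((a i).natDegree - b.natDegree)) →
      (Fin n → K[X]) ⧸ Mmod a :=
    Sum.elim (fun p => (X : K[X]) ^ (p.2 : ℕ) • v p.1)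
      (fun p => (X : K[X]) ^ (p.2 : ℕ) • b • (Mmod a).mkQ (Pi.single p.1 1))
  have hw : ∀ t, w t ∈ Submodule.span K (Set.range w) := fun t => Submodule.subset_span ⟨t, rfl⟩
  have hbS := smul_mem_of_dvd_or_dvd ha hab (Submodule.span K (Set.range w))
    (fun i j hj => hw (.inr ⟨i, j, hj⟩))
  have hspan : Set.range (fun p : Σ i : Fin l, Fin (d i) => (X : K[X]) ^ (p.2 : ℕ) • v p.1) ≤
      Submodule.span K (Set.range w) := by
    rintro _ ⟨⟨i, j⟩, rfl⟩
    refine smul_mem_of_mul_mem _ hb (fun q => ?_) (fun k hk => hw (.inl (i, ⟨k, hk⟩))) _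
    rw [mul_smul]
    exact hbS _
  simpa using (linearIndependent_le_span_aux' _ hindep _ hspan).trans (Fintype.card_range_le w)

/-- **Degree-sum bound from independent shifted families** (Corollary `cor:=>`).
Let `K = K[x]^n/⟨a_i ε'_i⟩` with `a_n | ... | a_1` and `f_i = deg a_i` (with `f_j = 0` for
`j > n`). If `v_1,...,v_l ∈ K` and `d ∈ ℕ^l` are such that `{x^j · v_i : 0 ≤ j < d_i}` is
K-linearly independent, then `Σ_{i=1}^l d_i ≤ Σ_{i=1}^l f_i`. -/
theorem sum_deg_le_of_indep {K : Type*} [Field K] {n : ℕ} (hn : 0 < n)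
    (a : Fin n → Polynomial K) (ha : ∀ i, a i ≠ 0)
    (hdvd : ∀ i j : Fin n, i ≤ j → a j ∣ a i)
    (f : ℕ → ℕ) (hf : ∀ i : Fin n, f (i : ℕ) = (a i).natDegree)
    (hf0 : ∀ i, n ≤ i → f i = 0)
    (l : ℕ) (hl : 1 ≤ l) (d : Fin l → ℕ)
    (v : Fin l → ((Fin n → Polynomial K) ⧸ Mmod a))
    (hindep : LinearIndependent K
      (fun p : Σ i : Fin l, Fin (d i) => ((X : Polynomial K) ^ (p.2 : ℕ)) • v p.1)) :
    ∑ i, d i ≤ ∑ i ∈ Finset.range l, f i := by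
  obtain ⟨b, hb, hab, hlt, hge⟩ : ∃ b : K[X], b ≠ 0 ∧ (∀ i, b ∣ a i ∨ a i ∣ b) ∧
      (∀ i < l, b.natDegree ≤ f i) ∧ ∀ i, l ≤ i → f i ≤ b.natDegree := by
    by_cases hln : l < n
    · refine ⟨a ⟨l, hln⟩, ha _, fun i => (le_total i ⟨l, hln⟩).imp (hdvd _ _) (hdvd _ _),
        fun i hi => ?_, fun i hi => ?_⟩
      · rw [hf ⟨i, hi.trans hln⟩]
        exact natDegree_le_of_dvd (hdvd _ _ hi.le) (ha _)
      · by_cases hin : i < n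
        · rw [hf ⟨i, hin⟩]
          exact natDegree_le_of_dvd (hdvd _ _ hi) (ha _)
        · simp [hf0 i (not_lt.mp hin)]
    · exact ⟨1, one_ne_zero, fun i => .inl (one_dvd _), by simp,
        fun i hi => by simp [hf0 i ((not_lt.mp hln).trans hi)]⟩
  refine (sum_le_of_linearIndependent_of_dvd_or_dvd ha hb hab hindep).trans_eq ?_
  have hsum : ∑ i, ((a i).natDegree - b.natDegree) =
      ∑ i ∈ Finset.range l, (f i - b.natDegree) := by
    simp_rw [← hf]
    rw [Fin.sum_univ_eq_sum_range (fun i => f i - b.natDegree),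
      Finset.sum_subset (Finset.range_mono (Nat.le_add_right n l)),
      Finset.sum_subset (Finset.range_mono (Nat.le_add_left l n))]
    · intro i _ hi
      simp [hge i (by simpa using hi)]
    · intro i _ hi
      simp [hf0 i (by simpa using hi)]
  rw [hsum, ← smul_eq_mul, ← Finset.card_range l, ← Finset.sum_const, Finset.card_range,
    ← Finset.sum_add_distrib]
  exact Finset.sum_congr rfl fun i hi => Nat.add_sub_cancel' (hlt i (Finset.mem_range.mp hi))
end
end

section
/- Let K be a field, m ≥ n ≥ 1, a_1,...,a_n ∈ K[x] nonzero with a_n | ... | a_1 and f_i = deg(a_i) (so f_1 ≥ ... ≥ f_n, extended by f_{n+1} = ... = f_m = 0), M = ⟨a_i(x)·ε'_i⟩ ⊆ K[x]^n, M ∈ K[x]^{m×n}, and s ∈ Z^m a shift. Let δ_M be the s-pivot degrees of the relation module A_{M,M} and r = rank_K(φ_M) where φ_M(p) = pM mod M. Then F_{δ_M} ≥_lex F_{d̄_r}, where F_{d̄_r} := min_{<lex} {F_d : d ∈ N^m, #F_d = r, and Σ_{i=1}^l d_i ≤ Σ_{i=1}^l f_i for all 1 ≤ l ≤ m}. -/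
open Polynomial

noncomputable section

/-- Lexicographic comparison of equal-cardinality families of monomials via their
≺-sorted lists. -/
def famLT {m : ℕ} (s : Fin m → ℤ) (F G : Finset (ℕ × Fin m)) : Prop :=
  ∃ μ, μ ∈ F ∧ μ ∉ G ∧ ∀ ν, sTopLT s ν μ → (ν ∈ F ↔ ν ∈ G)

/-- the family F_d = {x^i ε_j : 0 ≤ i < d_j, 1 ≤ j ≤ m} -/
def Fd {m : ℕ} (d : Fin m → ℕ) : Finset (ℕ × Fin m) :=
  Finset.univ.biUnion fun j => (Finset.range (d j)).image fun i => (i, j)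

/-- The nonzero coefficients of a row with pivot index `i` and pivot degree `d` sit at monomials
that do not exceed `x^d ε_i` in the `s`-TOP order. -/
lemma IsPivot.coeff_ne_zero_le {K : Type*} [Field K] {ν : ℕ} {s : Fin ν → ℤ}
    {p : Fin ν → Polynomial K} {i : Fin ν} {d : ℕ} (h : IsPivot s p i d)
    {j : Fin ν} {e : ℕ} (he : (p j).coeff e ≠ 0) :
    (e : ℤ) + s j < d + s i ∨ ((e : ℤ) + s j = d + s i ∧ j ≤ i) := by
  obtain ⟨hd, hmax, hlast⟩ := h
  have hpj : p j ≠ 0 := by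
    rintro h0
    simp [h0] at he
  have hdeg : (p j).degree = ((p j).natDegree : WithBot ℕ) := degree_eq_natDegree hpj
  have hle : WithBot.map (fun k : ℕ => (k : ℤ) + s j) (p j).degree ≤ rdeg s p :=
    Finset.le_sup (f := fun i => WithBot.map (fun d : ℕ => (d : ℤ) + s i) (p i).degree)
      (Finset.mem_univ j)
  have hlast := hlast j
  rw [← hmax, hd, hdeg] at hle hlast
  change (((((p j).natDegree : ℤ) + s j : ℤ)) : WithBot ℤ) ≤ (((d : ℤ) + s i : ℤ) : WithBot ℤ)
    at hle
  change (((((p j).natDegree : ℤ) + s j : ℤ)) : WithBot ℤ) = (((d : ℤ) + s i : ℤ) : WithBot ℤ) → _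
    at hlast
  rw [WithBot.coe_le_coe] at hle
  rw [WithBot.coe_inj] at hlast
  have hen : e ≤ (p j).natDegree := le_natDegree_of_ne_zero he
  by_cases heq : (e : ℤ) + s j = d + s i
  · exact Or.inr ⟨heq, hlast (by omega)⟩
  · left
    omega

/-- In the module spanned by the rows of a matrix in ordered weak Popov form with pivot
degrees `δ`, a row whose entries have degree below `δ` vanishes. -/
lemma eq_zero_of_mem_span_of_degree_lt {K : Type*} [Field K] {m : ℕ} {s : Fin m → ℤ}
    {P : Fin m → Fin m → Polynomial K} {δ : Fin m → ℕ} (hpiv : ∀ k, IsPivot s (P k) k (δ k))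
    {p : Fin m → Polynomial K} (hp : p ∈ Submodule.span (Polynomial K) (Set.range P))
    (hdeg : ∀ j, (p j).degree < δ j) : p = 0 := by
  obtain ⟨q, rfl⟩ := (Submodule.mem_span_range_iff_exists_fun _).1 hp
  by_contra hne
  classical
  have hS : (Finset.univ.filter fun k => q k ≠ 0).Nonempty := by
    by_contra hS
    rw [Finset.not_nonempty_iff_eq_empty, Finset.filter_eq_empty_iff] at hS
    exact hne (Finset.sum_eq_zero fun k _ => by
      have := hS (Finset.mem_univ k)
      rw [not_not] at this
      rw [this, zero_smul])
  obtain ⟨k, hk, hkmax⟩ := Finset.exists_max_image _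
    (fun k => toLex (((q k).natDegree : ℤ) + δ k + s k, k)) hS
  have hqk : q k ≠ 0 := (Finset.mem_filter.1 hk).2
  have hlow := hdeg k
  have hPk : (P k k).natDegree = δ k := natDegree_eq_of_degree_eq_some (hpiv k).1
  have hPk0 : P k k ≠ 0 := by
    intro h
    have := (hpiv k).1
    simp [h] at this
  have hzero : ((∑ i, q i • P i) k).coeff ((q k).natDegree + δ k) = 0 :=
    coeff_eq_zero_of_degree_lt (hlow.trans_le (by exact_mod_cast Nat.le_add_left _ _))
  rw [Finset.sum_apply, finsetSum_coeff, Finset.sum_eq_single k] at hzero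
  · rw [Pi.smul_apply, smul_eq_mul, ← hPk, coeff_mul_degree_add_degree] at hzero
    exact mul_ne_zero (leadingCoeff_ne_zero.2 hqk) (leadingCoeff_ne_zero.2 hPk0) hzero
  · intro i _ hik
    rw [Pi.smul_apply, smul_eq_mul, coeff_mul]
    refine Finset.sum_eq_zero fun x hx => ?_
    rw [Finset.HasAntidiagonal.mem_antidiagonal] at hx
    by_contra hx0
    have hq := left_ne_zero_of_mul hx0
    have hP := right_ne_zero_of_mul hx0
    have hqi : q i ≠ 0 := by
      rintro h0
      simp [h0] at hq
    have h1 : x.1 ≤ (q i).natDegree := le_natDegree_of_ne_zero hq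
    have h2 := (hpiv i).coeff_ne_zero_le hP
    have h3 := hkmax i (Finset.mem_filter.2 ⟨Finset.mem_univ _, hqi⟩)
    rw [Prod.Lex.toLex_le_toLex] at h3
    simp only at h3
    rcases h2 with h2 | ⟨h2, h2'⟩ <;> rcases h3 with h3 | ⟨h3, h3'⟩
    · omega
    · omega
    · omega
    · exact hik (le_antisymm h3' h2')
  · simp

section TruncComb

variable {K : Type*} [Field K] {Q : Type*} [AddCommGroup Q] [Module (Polynomial K) Q]
  [Module K Q] [IsScalarTower K (Polynomial K) Q] {ι : Type*} [Fintype ι]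

/-- The `K`-linear map sending `(p_i)` with `deg p_i < e_i` to `∑ p_i • w_i`. -/
def truncComb (w : ι → Q) (e : ι → ℕ) : ((i : ι) → degreeLT K (e i)) →ₗ[K] Q :=
  ∑ i, ((LinearMap.toSpanSingleton (Polynomial K) Q (w i)).restrictScalars K) ∘ₗ
    (degreeLT K (e i)).subtype ∘ₗ LinearMap.proj i

lemma truncComb_apply (w : ι → Q) (e : ι → ℕ) (p : (i : ι) → degreeLT K (e i)) :
    truncComb w e p = ∑ i, (p i : Polynomial K) • w i := by
  simp [truncComb]

lemma smul_mem_range_truncComb (w : ι → Q) (e : ι → ℕ) (i : ι) {p : Polynomial K}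
    (hp : p.degree < e i) : p • w i ∈ LinearMap.range (truncComb (K := K) w e) := by
  classical
  refine ⟨Pi.single i ⟨p, mem_degreeLT.2 hp⟩, ?_⟩
  rw [truncComb_apply, Finset.sum_eq_single i]
  · simp
  · intro j _ hj
    simp [Pi.single_eq_of_ne hj]
  · simp

lemma finiteDimensional_pi_degreeLT (e : ι → ℕ) :
    FiniteDimensional K ((i : ι) → degreeLT K (e i)) := by
  have : ∀ i, FiniteDimensional K (degreeLT K (e i)) := fun i =>
    (degreeLTEquiv K (e i)).symm.finiteDimensional
  infer_instance

lemma finrank_pi_degreeLT_s16 (e : ι → ℕ) :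
    Module.finrank K ((i : ι) → degreeLT K (e i)) = ∑ i, e i := by
  have : ∀ i, FiniteDimensional K (degreeLT K (e i)) := fun i =>
    (degreeLTEquiv K (e i)).symm.finiteDimensional
  rw [Module.finrank_pi_fintype]
  exact Finset.sum_congr rfl fun i _ => by
    rw [(degreeLTEquiv K (e i)).finrank_eq, Module.finrank_fin_fun]

lemma smul_mem_of_coeff_ne_zero {R : Submodule K Q} {v : Q} {q : Polynomial K}
    (h : ∀ k, q.coeff k ≠ 0 → (X ^ k : Polynomial K) • v ∈ R) : q • v ∈ R := by
  rw [q.as_sum_support_C_mul_X_pow, Finset.sum_smul]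
  refine Submodule.sum_mem _ fun k hk => ?_
  rw [← smul_eq_C_mul, smul_assoc]
  exact R.smul_mem _ (h k (mem_support_iff.1 hk))

/-- If the rows of `P` are relations between the `v_i` and are in ordered weak Popov form with
pivot degrees `δ`, then the `x^k v_i` with `k < δ_i` span all `x^k v_i` over `K`. -/
lemma X_pow_smul_mem_range_truncComb {m : ℕ} {s : Fin m → ℤ}
    {P : Fin m → Fin m → Polynomial K} {δ : Fin m → ℕ} (hpiv : ∀ k, IsPivot s (P k) k (δ k))
    (v : Fin m → Q) (hv : ∀ k, ∑ i, P k i • v i = 0) (k : ℕ) (j : Fin m) :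
    (X ^ k : Polynomial K) • v j ∈ LinearMap.range (truncComb (K := K) v δ) := by
  obtain ⟨c, hc⟩ : ∃ c : ℤ, ∀ i, 0 ≤ s i + c := by
    refine ⟨∑ i, |s i|, fun i => ?_⟩
    have h1 := Finset.single_le_sum (f := fun i => |s i|) (fun i _ => abs_nonneg _)
      (Finset.mem_univ i)
    have h2 := neg_abs_le (s i)
    linarith
  set R := LinearMap.range (truncComb (K := K) v δ)
  suffices H : ∀ t : ℕ ×ₗ Fin m, ∀ (k : ℕ) (j : Fin m), toLex ((((k : ℤ) + (s j + c)).toNat), j) = t →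
      (X ^ k : Polynomial K) • v j ∈ R from H _ k j rfl
  intro t
  induction t using WellFoundedLT.induction with
  | ind t ih =>
  rintro k j rfl
  replace ih : ∀ (k' : ℕ) (j' : Fin m), sTopLT s (k', j') (k, j) → (X ^ k' : Polynomial K) • v j' ∈ R := by
    intro k' j' hlt
    refine ih _ ?_ k' j' rfl
    rw [Prod.Lex.toLex_lt_toLex]
    have h1 := hc j
    have h2 := hc j'
    rcases hlt with hlt | ⟨hlt, hlt'⟩
    · left
      simp only at hlt ⊢
      omega
    · right
      simp only at hlt hlt' ⊢
      exact ⟨by omega, hlt'⟩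
  rcases lt_or_ge k (δ j) with hk | hk
  · exact smul_mem_range_truncComb v δ j (by rw [degree_X_pow]; exact_mod_cast hk)
  obtain ⟨t, rfl⟩ := Nat.exists_eq_add_of_le hk
  have hrel : ∑ i, (X ^ t * P j i) • v i = 0 := by
    simp_rw [mul_smul, ← Finset.smul_sum, hv, smul_zero]
  set c₀ := (P j j).coeff (δ j)
  have hc₀ : c₀ ≠ 0 := coeff_ne_zero_of_eq_degree (hpiv j).1
  have hsplit : c₀ • (X ^ (δ j + t) : Polynomial K) • v j =
      -((X ^ t * P j j - c₀ • X ^ (δ j + t)) • v j) -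
        ∑ i ∈ Finset.univ.erase j, (X ^ t * P j i) • v i := by
    rw [← Finset.add_sum_erase _ _ (Finset.mem_univ j)] at hrel
    rw [sub_smul, smul_assoc, eq_neg_of_add_eq_zero_right hrel]
    abel
  rw [← R.smul_mem_iff hc₀, hsplit]
  refine R.sub_mem (R.neg_mem ?_) (R.sum_mem fun i hi => ?_)
  · refine smul_mem_of_coeff_ne_zero fun e he => ih _ _ ?_
    rw [coeff_sub, coeff_smul, coeff_X_pow, coeff_X_pow_mul'] at he
    by_cases hte : t ≤ e
    · rw [if_pos hte] at he
      by_cases heq : e = δ j + t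
      · subst heq
        simp [c₀] at he
      · rw [if_neg heq, smul_zero, sub_zero] at he
        rcases (hpiv j).coeff_ne_zero_le he with h | h
        · left
          simp only
          omega
        · omega
    · rw [if_neg hte, if_neg (by omega)] at he
      simp at he
  · refine smul_mem_of_coeff_ne_zero fun e he => ih _ _ ?_
    rw [coeff_X_pow_mul'] at he
    by_cases hte : t ≤ e
    · rw [if_pos hte] at he
      rcases (hpiv j).coeff_ne_zero_le he with h | ⟨h, h'⟩
      · left
        simp only
        omega
      · right
        simp only
        exact ⟨by omega, lt_of_le_of_ne h' (Finset.ne_of_mem_erase hi)⟩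
    · rw [if_neg hte] at he
      exact absurd rfl he

end TruncComb

/-- A submodule of `K[x]^n / ⟨a_i ε'_i⟩` generated by `l` elements has dimension at most
`∑_{i < l} deg a_i`: an injective `truncComb` with `l` generators has at most that many
monomials. -/
lemma sum_le_of_injective_truncComb {K : Type*} [Field K] {n : ℕ}
    {a : Fin n → Polynomial K} (ha : ∀ i, a i ≠ 0)
    (hdvd : ∀ i j : Fin n, i ≤ j → a j ∣ a i)
    {f : ℕ → ℕ} (hf : ∀ i : Fin n, f (i : ℕ) = (a i).natDegree)
    (hf0 : ∀ i, n ≤ i → f i = 0) {ι : Type*} [Fintype ι]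
    (v : ι → (Fin n → Polynomial K) ⧸ Mmod a) (e : ι → ℕ)
    (hinj : Function.Injective (truncComb (K := K) v e)) :
    ∑ i, e i ≤ ∑ i ∈ Finset.range (Fintype.card ι), f i := by
  set l := Fintype.card ι
  obtain ⟨b, hb0, hbdeg, hb1, hb2⟩ : ∃ b : Polynomial K, b ≠ 0 ∧ b.natDegree = f l ∧
      (∀ i : Fin n, (i : ℕ) < l → b ∣ a i) ∧ (∀ i : Fin n, l ≤ (i : ℕ) → a i ∣ b) := by
    rcases lt_or_ge l n with hl | hl
    · exact ⟨a ⟨l, hl⟩, ha _, (hf ⟨l, hl⟩).symm, fun i hi => hdvd _ _ hi.le,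
        fun i hi => hdvd _ _ hi⟩
    · exact ⟨1, one_ne_zero, by rw [hf0 l hl, natDegree_one], fun i _ => one_dvd _,
        fun i hi => absurd i.2 (by omega)⟩
  have hle : ∀ i < l, f l ≤ f i := by
    intro i hi
    rcases lt_or_ge i n with hin | hin
    · rw [← hbdeg, hf ⟨i, hin⟩]
      exact natDegree_le_of_dvd (hb1 ⟨i, hin⟩ hi) (ha _)
    · rw [hf0 l (by omega)]
      exact Nat.zero_le _
  let u : Fin n → (Fin n → Polynomial K) ⧸ Mmod a := fun i =>
    Submodule.Quotient.mk (Pi.single i 1)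
  have hau : ∀ i, a i • u i = 0 := by
    intro i
    rw [← Submodule.Quotient.mk_smul, Submodule.Quotient.mk_eq_zero, ← Pi.single_smul,
      smul_eq_mul, mul_one]
    exact Submodule.subset_span ⟨i, rfl⟩
  let w : ι ⊕ Fin l → (Fin n → Polynomial K) ⧸ Mmod a :=
    Sum.elim v fun i => if h : (i : ℕ) < n then b • u ⟨i, h⟩ else 0
  let e' : ι ⊕ Fin l → ℕ := Sum.elim (fun _ => f l) fun i => f i - f l
  have hb : ∀ y, b • y ∈ LinearMap.range (truncComb (K := K) w e') := by
    intro y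
    obtain ⟨z, rfl⟩ := Submodule.Quotient.mk_surjective _ y
    have hz : (Submodule.Quotient.mk z : (Fin n → Polynomial K) ⧸ Mmod a) =
        ∑ i, z i • u i := by
      conv_lhs => rw [pi_eq_sum_univ' z]
      rw [← Submodule.mkQ_apply, map_sum]
      refine Finset.sum_congr rfl fun i _ => ?_
      rw [map_smul, Submodule.mkQ_apply]
    rw [hz, Finset.smul_sum]
    refine Submodule.sum_mem _ fun i _ => ?_
    rcases lt_or_ge (i : ℕ) l with hi | hi
    · obtain ⟨c, hc⟩ := hb1 i hi
      have hc0 : c ≠ 0 := by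
        rintro rfl
        exact ha i (by rw [hc, mul_zero])
      have hdc : c.degree = ((f i - f l : ℕ) : WithBot ℕ) := by
        rw [degree_eq_natDegree hc0, hf i, hc, natDegree_mul hb0 hc0, hbdeg,
          Nat.add_sub_cancel_left]
      have key : b • z i • u i = (z i % c) • w (Sum.inr ⟨i, hi⟩) := by
        have hw : w (Sum.inr ⟨i, hi⟩) = b • u i := by simp [w]
        rw [hw]
        conv_lhs => rw [← EuclideanDomain.div_add_mod (z i) c]
        rw [add_smul, smul_add, smul_smul, smul_smul, smul_smul,
          show b * (c * (z i / c)) = (z i / c) * a i by rw [hc]; ring, mul_smul, hau, smul_zero,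
          zero_add, mul_comm]
      rw [key]
      refine smul_mem_range_truncComb w e' _ ?_
      change (z i % c).degree < ((f i - f l : ℕ) : WithBot ℕ)
      rw [← hdc]
      exact EuclideanDomain.mod_lt _ hc0
    · obtain ⟨c, hc⟩ := hb2 i hi
      rw [smul_smul, show b * z i = (c * z i) * a i by rw [hc]; ring, mul_smul, hau, smul_zero]
      exact Submodule.zero_mem _
  have hrange : LinearMap.range (truncComb (K := K) v e) ≤
      LinearMap.range (truncComb (K := K) w e') := by
    rintro _ ⟨p, rfl⟩
    rw [truncComb_apply]
    refine Submodule.sum_mem _ fun i _ => ?_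
    rw [← EuclideanDomain.div_add_mod (p i : Polynomial K) b, add_smul, mul_smul]
    refine Submodule.add_mem _ (hb _) (smul_mem_range_truncComb w e' (Sum.inl i) ?_)
    change _ < ((f l : ℕ) : WithBot ℕ)
    rw [← hbdeg, ← degree_eq_natDegree hb0]
    exact EuclideanDomain.mod_lt _ hb0
  have := finiteDimensional_pi_degreeLT (K := K) e'
  calc ∑ i, e i = Module.finrank K (LinearMap.range (truncComb (K := K) v e)) := by
        rw [LinearMap.finrank_range_of_inj hinj, finrank_pi_degreeLT_s16]
    _ ≤ Module.finrank K (LinearMap.range (truncComb (K := K) w e')) :=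
        Submodule.finrank_mono hrange
    _ ≤ ∑ i, e' i := by
        rw [← finrank_pi_degreeLT_s16 (K := K) e']
        exact LinearMap.finrank_range_le _
    _ = ∑ i ∈ Finset.range l, f l + ∑ i ∈ Finset.range l, (f i - f l) := by
        rw [Fintype.sum_sum_type, ← Fin.sum_univ_eq_sum_range (fun i => f i - f l)]
        simp [e', l]
    _ = ∑ i ∈ Finset.range l, f i := by
        rw [← Finset.sum_add_distrib]
        exact Finset.sum_congr rfl fun i hi => Nat.add_sub_cancel' (hle i (Finset.mem_range.1 hi))

/-- **Constraint on the pivot degrees of the relation module** (Theorem `thm:ineqrdeg`).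
If `δ` are the s-pivot degrees of `A_{M,M}` and `r = rank_K(φ_M)`, then
`F_δ ≥_lex F_{d̄_r}`, where `F_{d̄_r}` is the lexicographically smallest family `F_d` with
`Σ_j d_j = r` and `Σ_{i=1}^l d_i ≤ Σ_{i=1}^l f_i` for all `1 ≤ l ≤ m`. -/
theorem pivot_degrees_ge_generic {K : Type*} [Field K] {m n : ℕ} (hmn : n ≤ m) (hn : 0 < n)
    (a : Fin n → Polynomial K) (ha : ∀ i, a i ≠ 0)
    (hdvd : ∀ i j : Fin n, i ≤ j → a j ∣ a i)
    (f : ℕ → ℕ) (hf : ∀ i : Fin n, f (i : ℕ) = (a i).natDegree)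
    (hf0 : ∀ i, n ≤ i → f i = 0)
    (M : Matrix (Fin m) (Fin n) (Polynomial K)) (s : Fin m → ℤ)
    (P : Fin m → Fin m → Polynomial K) (δ : Fin m → ℕ)
    (hbasis : IsBasisOf P ((Mmod a).comap (Matrix.vecMulLinear (R := Polynomial K) M)))
    (hpiv : ∀ k, IsPivot s (P k) k (δ k))
    (r : ℕ)
    (hr : r = Module.finrank K (Submodule.span K (Set.range fun μ : ℕ × Fin m =>
      (Submodule.Quotient.mk (pmul M (monov μ)) : (Fin n → Polynomial K) ⧸ Mmod a))))
    (dbar : Fin m → ℕ)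
    (hdbar : (∑ j, dbar j) = r ∧
      ∀ l : ℕ, 1 ≤ l → l ≤ m →
        (∑ j ∈ Finset.univ.filter (fun j : Fin m => (j : ℕ) < l), dbar j) ≤
          ∑ i ∈ Finset.range l, f i)
    (hdbarmin : ∀ d' : Fin m → ℕ,
      ((∑ j, d' j) = r ∧
        ∀ l : ℕ, 1 ≤ l → l ≤ m →
          (∑ j ∈ Finset.univ.filter (fun j : Fin m => (j : ℕ) < l), d' j) ≤
            ∑ i ∈ Finset.range l, f i) →
      Fd d' = Fd dbar ∨ famLT s (Fd dbar) (Fd d')) :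
    Fd δ = Fd dbar ∨ famLT s (Fd dbar) (Fd δ) := by
  let Φ : (Fin m → Polynomial K) →ₗ[Polynomial K] (Fin n → Polynomial K) ⧸ Mmod a :=
    (Mmod a).mkQ ∘ₗ Matrix.vecMulLinear M
  have hΦ : ∀ p, Submodule.Quotient.mk (pmul M p) = Φ p := fun p => rfl
  have hker : ∀ p, Φ p = 0 ↔ p ∈ Submodule.span (Polynomial K) (Set.range P) := fun p => by
    rw [hbasis.2, Submodule.mem_comap]
    exact Submodule.Quotient.mk_eq_zero _
  let v : Fin m → (Fin n → Polynomial K) ⧸ Mmod a := fun j => Φ (Pi.single j 1)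
  have hΦv : ∀ p, Φ p = ∑ i, p i • v i := by
    intro p
    conv_lhs => rw [← Finset.univ_sum_single p]
    rw [map_sum]
    refine Finset.sum_congr rfl fun i _ => ?_
    rw [← map_smul, ← Pi.single_smul, smul_eq_mul, mul_one]
  have hmono : ∀ μ : ℕ × Fin m, Φ (monov μ) = (X ^ μ.1 : Polynomial K) • v μ.2 := by
    intro μ
    rw [← map_smul, ← Pi.single_smul, smul_eq_mul, mul_one]
    rfl
  have hv : ∀ k, ∑ i, P k i • v i = 0 := fun k => by
    rw [← hΦv, hker]
    exact Submodule.subset_span ⟨k, rfl⟩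
  have hzero : ∀ p : Fin m → Polynomial K, (∀ j, (p j).degree < δ j) →
      ∑ i, p i • v i = 0 → p = 0 := fun p hp h0 =>
    eq_zero_of_mem_span_of_degree_lt hpiv ((hker p).1 ((hΦv p).trans h0)) hp
  refine hdbarmin δ ⟨?_, fun l _ hl => ?_⟩
  · have hinj : Function.Injective (truncComb (K := K) v δ) := by
      rw [← LinearMap.ker_eq_bot, LinearMap.ker_eq_bot']
      intro p hp
      rw [truncComb_apply] at hp
      have := hzero (fun j => p j) (fun j => mem_degreeLT.1 (p j).2) hp
      ext j : 2
      exact congrFun this j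
    have hspan : Submodule.span K (Set.range fun μ : ℕ × Fin m =>
        (Submodule.Quotient.mk (pmul M (monov μ)) : (Fin n → Polynomial K) ⧸ Mmod a)) =
        LinearMap.range (truncComb (K := K) v δ) := by
      simp_rw [hΦ, hmono]
      refine le_antisymm (Submodule.span_le.2 ?_) ?_
      · rintro _ ⟨μ, rfl⟩
        exact X_pow_smul_mem_range_truncComb hpiv v hv _ _
      · rintro _ ⟨p, rfl⟩
        rw [truncComb_apply]
        exact Submodule.sum_mem _ fun j _ => smul_mem_of_coeff_ne_zero fun k _ =>
          Submodule.subset_span ⟨(k, j), rfl⟩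
    rw [hr, hspan, LinearMap.finrank_range_of_inj hinj, finrank_pi_degreeLT_s16]
  · have hinj : Function.Injective (truncComb (K := K) (fun j : Fin l => v (Fin.castLE hl j))
        fun j => δ (Fin.castLE hl j)) := by
      rw [← LinearMap.ker_eq_bot, LinearMap.ker_eq_bot']
      intro p hp
      rw [truncComb_apply] at hp
      let p' : Fin m → Polynomial K := fun j => if h : (j : ℕ) < l then p ⟨j, h⟩ else 0
      have hp' : p' = 0 := by
        refine hzero p' (fun j => ?_) ?_
        · by_cases h : (j : ℕ) < l
          · simp only [p', dif_pos h]
            exact mem_degreeLT.1 (p ⟨j, h⟩).2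
          · simp [p', dif_neg h]
        · rw [← hp]
          symm
          refine Finset.sum_of_injOn (Fin.castLE hl) (Fin.castLE_injective hl).injOn
            (fun _ _ => Finset.mem_coe.2 (Finset.mem_univ _)) (fun j _ hj => ?_) fun j _ => ?_
          · have h : ¬ (j : ℕ) < l := fun h =>
              hj ⟨⟨j, h⟩, Finset.mem_coe.2 (Finset.mem_univ _), rfl⟩
            simp [p', dif_neg h]
          · simp [p']
      ext j : 2
      simpa [p'] using congrFun hp' (Fin.castLE hl j)
    have hsum := sum_le_of_injective_truncComb ha hdvd hf hf0 _ _ hinj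
    rw [Fintype.card_fin] at hsum
    refine le_of_eq_of_le (Eq.symm ?_) hsum
    refine Finset.sum_of_injOn (Fin.castLE hl) (Fin.castLE_injective hl).injOn
      (fun j _ => by simp) (fun j hj hj' => ?_) fun j _ => rfl
    exact absurd ⟨⟨j, (Finset.mem_filter.1 hj).2⟩, Finset.mem_coe.2 (Finset.mem_univ _), rfl⟩ hj'
end
end

section
/- Let m ≥ 1, s ∈ Z^m with s̄ = max_i s_i, f = (f_1,...,f_m) ∈ N^m non-increasing, and let p and u be the quotient and remainder of the Euclidean division Σ_{i=1}^m (f_i + s_i) = p·m + u with 0 ≤ u < m. Define the tuple p⃗ = (p+1,...,p+1,p,...,p) with u entries equal to p+1 followed by m-u entries equal to p. Assume (i) p ≥ s̄, and (ii) Σ_{i=1}^l p⃗_i ≤ Σ_{i=1}^l (f_i + s_i) for all 1 ≤ l ≤ m-1. Then the generic s-row degree vector satisfies d̄_Σ + s = p⃗, where Σ = Σ_{i=1}^m f_i and d̄_Σ ∈ N^m is defined by F_{d̄_Σ} := min_{<lex} {F_d : d ∈ N^m, Σ_j d_j = Σ, and Σ_{i=1}^l d_i ≤ Σ_{i=1}^l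 f_i for all 1 ≤ l ≤ m}. -/
theorem mem_Fd_iff {m : ℕ} (d : Fin m → ℕ) (a : ℕ) (j : Fin m) :
    (a, j) ∈ Fd d ↔ a < d j := by
  simp [Fd]

theorem Fd_injective {m : ℕ} : Function.Injective (Fd (m := m)) := by
  intro d e h
  funext j
  have key (a : ℕ) : a < d j ↔ a < e j := by rw [← mem_Fd_iff, ← mem_Fd_iff, h]
  exact le_antisymm (not_lt.mp fun hlt => lt_irrefl _ ((key _).mp hlt))
    (not_lt.mp fun hlt => lt_irrefl _ ((key _).mpr hlt))

/-- If `d + s = (p+1,...,p+1,p,...,p)`, no family `F_e` with `∑ e = ∑ d` is smaller than `F_d`. -/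
theorem not_famLT_Fd_of_add_eq {m : ℕ} {s : Fin m → ℤ} {p : ℤ} {u : ℕ} {d e : Fin m → ℕ}
    (hd : ∀ i : Fin m, (d i : ℤ) + s i = if (i : ℕ) < u then p + 1 else p)
    (hsum : ∑ j, e j = ∑ j, d j) : ¬ famLT s (Fd e) (Fd d) := by
  rintro ⟨⟨a, j⟩, he, hnd, hlt⟩
  rw [mem_Fd_iff] at he hnd
  have hj : d j < e j := by omega
  obtain ⟨k, hk⟩ : ∃ k, e k < d k := by
    by_contra! h
    exact (Finset.sum_lt_sum (fun i _ => h i) ⟨j, Finset.mem_univ j, hj⟩).ne' hsum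
  have hprec : sTopLT s (e k, k) (a, j) := by
    have hdj := hd j
    have hdk := hd k
    simp only [sTopLT, Fin.lt_def]
    split_ifs at hdj hdk <;> omega
  have := hlt _ hprec
  rw [mem_Fd_iff, mem_Fd_iff] at this
  omega

/-- **Nice form of the generic row degree** (Theorem `thm:drspecialcase`).
Let `f ∈ ℕ^m` be non-increasing, `s ∈ ℤ^m` with maximum `s̄`, and let `p, u` be the
quotient and remainder of `Σ (f_i + s_i) = p·m + u`. Set `p⃗ = (p+1,...,p+1,p,...,p)`
(`u` entries `p+1`). If `p ≥ s̄` and `Σ_{i=1}^l p⃗_i ≤ Σ_{i=1}^l (f_i + s_i)` for all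
`1 ≤ l ≤ m-1`, then the generic pivot degree `d̄_Σ` (the exponent vector of the
lexicographically smallest family `F_d` with `Σ d_j = Σ f_i` and partial-sum constraints)
satisfies `d̄_Σ + s = p⃗`. -/
theorem generic_row_degree_nice_form (m : ℕ) (hm : 0 < m) (s : Fin m → ℤ) (sbar : ℤ)
    (hsb1 : ∀ i, s i ≤ sbar) (hsb2 : ∃ i, s i = sbar)
    (f : Fin m → ℕ) (hfmono : ∀ i j : Fin m, i ≤ j → f j ≤ f i)
    (p : ℤ) (u : ℕ) (hu : u < m)
    (hdiv : (∑ i, ((f i : ℤ) + s i)) = p * m + u)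
    (pv : Fin m → ℤ) (hpv : ∀ i : Fin m, pv i = if (i : ℕ) < u then p + 1 else p)
    (h1 : sbar ≤ p)
    (h2 : ∀ l : ℕ, 1 ≤ l → l ≤ m - 1 →
      (∑ i ∈ Finset.univ.filter (fun i : Fin m => (i : ℕ) < l), pv i) ≤
        ∑ i ∈ Finset.univ.filter (fun i : Fin m => (i : ℕ) < l), ((f i : ℤ) + s i))
    (Sig : ℕ) (hSig : Sig = ∑ i, f i)
    (dbar : Fin m → ℕ)
    (hdbar : (∑ j, dbar j) = Sig ∧
      ∀ l : ℕ, 1 ≤ l → l ≤ m →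
        (∑ j ∈ Finset.univ.filter (fun j : Fin m => (j : ℕ) < l), dbar j) ≤
          ∑ i ∈ Finset.univ.filter (fun i : Fin m => (i : ℕ) < l), f i)
    (hdbarmin : ∀ d' : Fin m → ℕ,
      ((∑ j, d' j) = Sig ∧
        ∀ l : ℕ, 1 ≤ l → l ≤ m →
          (∑ j ∈ Finset.univ.filter (fun j : Fin m => (j : ℕ) < l), d' j) ≤
            ∑ i ∈ Finset.univ.filter (fun i : Fin m => (i : ℕ) < l), f i) →
      Fd d' = Fd dbar ∨ famLT s (Fd dbar) (Fd d')) :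
    ∀ i : Fin m, (dbar i : ℤ) + s i = pv i := by
  have hpv_le (i : Fin m) : p ≤ pv i := by rw [hpv]; split_ifs <;> omega
  obtain ⟨d, hd⟩ : ∃ d : Fin m → ℕ, ∀ i, (d i : ℤ) = pv i - s i :=
    ⟨fun i => (pv i - s i).toNat, fun i => Int.toNat_of_nonneg (by
      have := hpv_le i
      have := hsb1 i
      omega)⟩
  have hpvsum : ∑ i, pv i = p * m + u := by
    have hcard : (Finset.univ.filter fun i : Fin m => (i : ℕ) < u).card = u := by
      rw [Fin.card_filter_val_lt, min_eq_right hu.le]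
    have hsplit (i : Fin m) : pv i = p + if (i : ℕ) < u then 1 else 0 := by
      rw [hpv]; split_ifs <;> simp
    simp_rw [hsplit, Finset.sum_add_distrib, Finset.sum_boole, hcard]
    simp [mul_comm]
  have hdsum : ∑ j, d j = Sig := by
    zify
    rw [Finset.sum_add_distrib] at hdiv
    simp only [hd, Finset.sum_sub_distrib, hSig, Nat.cast_sum]
    linarith
  have hdle (l : ℕ) (hl : 1 ≤ l) (hlm : l ≤ m) :
      (∑ j ∈ Finset.univ.filter (fun j : Fin m => (j : ℕ) < l), d j) ≤
        ∑ i ∈ Finset.univ.filter (fun i : Fin m => (i : ℕ) < l), f i := by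
    rcases hlm.lt_or_eq with hlt | rfl
    · have h := h2 l hl (by omega)
      rw [Finset.sum_add_distrib] at h
      rw [← Nat.cast_le (α := ℤ)]
      simp only [Nat.cast_sum, hd, Finset.sum_sub_distrib]
      linarith
    · simp [hdsum, hSig]
  rcases hdbarmin d ⟨hdsum, hdle⟩ with h | h
  · intro i
    rw [← Fd_injective h, hd]
    ring
  · refine absurd h (not_famLT_Fd_of_add_eq (p := p) (u := u) (fun i => ?_)
      (hdbar.1.trans hdsum.symm))
    rw [hd, ← hpv]
    ring
end
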